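/- arXiv:2308.06359 — 9 statements merged into one kernel-verified Lean document; each statement's English description precedes it below -/
import Mathlib

section
/- Let c be a positive integer, χ a Dirichlet character modulo c, and m an integer with gcd(m,c) = 1. Then S_χ(m,1;c) = (1/φ(c)) · ∑_{ψ} conj(ψ(m)) · τ(ψ) · τ(χψ), where the sum runs over all Dirichlet characters ψ modulo c and φ denotes Euler's totient function. -/
open Complex Finset

noncomputable def eZMod (c : ℕ) (z : ZMod c) : ℂ :=
  Complex.exp (2 * Real.pi * Complex.I * (z.val : ℂ) / (c : ℂ))

/-- Twisted Kloosterman sum `S_χ(m,n;c)`. -/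
noncomputable def klooTwisted (c : ℕ) [NeZero c] (χ : DirichletCharacter ℂ c)
    (m n : ZMod c) : ℂ :=
  ∑ x : (ZMod c)ˣ, (starRingEnd ℂ) (χ x) *
    eZMod c (m * (x : ZMod c) + n * ((x⁻¹ : (ZMod c)ˣ) : ZMod c))

/-- Gauss sum `τ(χ)` of a Dirichlet character modulo `N`. -/
noncomputable def gaussS (N : ℕ) [NeZero N] (χ : DirichletCharacter ℂ N) : ℂ :=
  ∑ x : ZMod N, χ x * eZMod N x

theorem eZMod_add (c : ℕ) [NeZero c] (a b : ZMod c) :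
    eZMod c (a + b) = eZMod c a * eZMod c b := by
  have h (z : ZMod c) : eZMod c z = ZMod.stdAddChar z := by
    rw [ZMod.stdAddChar_apply, ZMod.toCircle_apply]
    rfl
  simp only [h, AddChar.map_add_eq_mul]

theorem conj_apply_unit {c : ℕ} [NeZero c] (χ : DirichletCharacter ℂ c) (u : (ZMod c)ˣ) :
    (starRingEnd ℂ) (χ u) = χ ((u⁻¹ : (ZMod c)ˣ) : ZMod c) := by
  rw [← Ring.inverse_unit, ← MulChar.inv_apply]
  exact MulChar.star_apply' χ u

theorem gaussS_eq_sum_units (c : ℕ) [NeZero c] (χ : DirichletCharacter ℂ c) :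
    gaussS c χ = ∑ u : (ZMod c)ˣ, χ u * eZMod c u := by
  refine (Fintype.sum_of_injective _ Units.val_injective _ _ (fun x hx ↦ ?_) fun _ ↦ rfl).symm
  rw [χ.map_nonunit (fun ⟨u, hu⟩ ↦ hx ⟨u, hu⟩), zero_mul]

theorem sum_conj_mul_gaussS_mul_gaussS (c : ℕ) [NeZero c] (χ : DirichletCharacter ℂ c)
    (m : (ZMod c)ˣ) :
    ∑ ψ : DirichletCharacter ℂ c, (starRingEnd ℂ) (ψ m) * gaussS c ψ * gaussS c (χ * ψ) =
      c.totient * klooTwisted c χ m 1 := by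
  have expand (ψ : DirichletCharacter ℂ c) :
      (starRingEnd ℂ) (ψ m) * gaussS c ψ * gaussS c (χ * ψ) =
        ∑ b : (ZMod c)ˣ, ∑ a : (ZMod c)ˣ,
          χ b * eZMod c (a + b) * ψ ((m⁻¹ * a * b : (ZMod c)ˣ) : ZMod c) := by
    rw [conj_apply_unit, gaussS_eq_sum_units, gaussS_eq_sum_units, mul_assoc, sum_mul_sum]
    simp only [mul_sum]
    rw [sum_comm]
    refine sum_congr rfl fun b _ ↦ sum_congr rfl fun a _ ↦ ?_
    rw [eZMod_add, Units.val_mul, Units.val_mul, map_mul, map_mul, MulChar.mul_apply]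
    ring
  simp only [expand]
  rw [sum_comm, klooTwisted, mul_sum, ← Equiv.sum_comp (Equiv.inv (ZMod c)ˣ)]
  refine sum_congr rfl fun x _ ↦ ?_
  rw [sum_comm]
  simp only [← mul_sum, DirichletCharacter.sum_characters_eq, Units.val_eq_one]
  rw [sum_eq_single (m * x)]
  · simp [conj_apply_unit]
    ring
  · intro a _ ha
    rw [if_neg, mul_zero]
    contrapose! ha
    have := congrArg (fun y ↦ m * y * x) ha
    simpa [mul_assoc] using this
  · simp

/-- Fourier decomposition of the twisted Kloosterman sum into
multiplicative characters. -/
theorem klooTwisted_eq_sum_gauss (c : ℕ) [NeZero c] (χ : DirichletCharacter ℂ c)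
    (m : ℤ) (hm : Int.gcd m c = 1) :
    klooTwisted c χ (m : ZMod c) 1 =
      (1 / (Nat.totient c : ℂ)) *
        ∑ ψ : DirichletCharacter ℂ c,
          (starRingEnd ℂ) (ψ (m : ZMod c)) * gaussS c ψ * gaussS c (χ * ψ) := by
  have hu : IsUnit (m : ZMod c) := by
    rw [ZMod.coe_int_isUnit_iff_isCoprime, Int.isCoprime_iff_gcd_eq_one, Int.gcd_comm]
    exact hm
  obtain ⟨u, hu⟩ := hu
  have hc : (c.totient : ℂ) ≠ 0 :=
    Nat.cast_ne_zero.mpr (Nat.totient_pos.mpr (NeZero.pos c)).ne'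
  rw [← hu, sum_conj_mul_gaussS_mul_gaussS, one_div, inv_mul_cancel_left₀ hc]
end

section
/- Let p be an odd prime, k ≥ 1 an integer, and let b, m, n be positive integers not divisible by p. Let χ be a Dirichlet character modulo p^k, and let c = b·p^r where r ≥ 2k. Then χ(m) · conj(χ(n)) · S_{χ̄²}(m,n;c) = S(m,n;c). -/
open Complex Finset

/-- Ordinary Kloosterman sum `S(m,n;c)`. -/
noncomputable def klooOrd (c : ℕ) [NeZero c] (m n : ZMod c) : ℂ :=
  ∑ x : (ZMod c)ˣ, eZMod c (m * (x : ZMod c) + n * ((x⁻¹ : (ZMod c)ˣ) : ZMod c))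

/-- `S_{χ̄²}(m,n;c) = ∑_{x mod c, (x,c)=1} χ(x)² e_c(mx + n x̄)`, where `χ` is a character
modulo `q` with `q ∣ c` and is evaluated at `x mod q`. -/
noncomputable def SChiSq (q c : ℕ) [NeZero c] (h : q ∣ c) (χ : DirichletCharacter ℂ q)
    (m n : ZMod c) : ℂ :=
  ∑ x : (ZMod c)ˣ, (χ (ZMod.castHom h (ZMod q) (x : ZMod c)))^2 *
    eZMod c (m * (x : ZMod c) + n * ((x⁻¹ : (ZMod c)ˣ) : ZMod c))

lemma eZMod_eq_stdAddChar (c : ℕ) [NeZero c] (z : ZMod c) : eZMod c z = ZMod.stdAddChar z := by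
  rw [ZMod.stdAddChar_apply, ZMod.toCircle_apply, eZMod]

/-- The geometric sum over the subgroup `d ℤ / q d ℤ` detects divisibility by `q`. -/
lemma sum_stdAddChar_eq_zero {q d c : ℕ} [NeZero c] (hc : c = q * d) (hq : q ∣ c) (y : ZMod c)
    (hy : ZMod.castHom hq (ZMod q) y ≠ 0) :
    ∑ t ∈ range q, ZMod.stdAddChar ((t : ZMod c) * ((d : ZMod c) * y)) = 0 := by
  have hd : 0 < d := Nat.pos_of_ne_zero fun h ↦ NeZero.ne c (by simp [hc, h])
  have hne : ZMod.stdAddChar ((d : ZMod c) * y) ≠ 1 := by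
    rw [← AddChar.map_zero_eq_one (ZMod.stdAddChar (N := c))]
    refine fun h ↦ hy ?_
    have h0 := ZMod.injective_stdAddChar h
    rw [← ZMod.natCast_zmod_val y] at h0 ⊢
    rw [← Nat.cast_mul, ZMod.natCast_eq_zero_iff] at h0
    rw [map_natCast, ZMod.natCast_eq_zero_iff]
    refine Nat.dvd_of_mul_dvd_mul_left hd ?_
    rwa [mul_comm d q, ← hc]
  have hpow : ZMod.stdAddChar ((d : ZMod c) * y) ^ q = 1 := by
    rw [← AddChar.map_nsmul_eq_pow, nsmul_eq_mul, ← mul_assoc, ← Nat.cast_mul, ← hc]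
    simp
  simp_rw [← nsmul_eq_mul _ ((d : ZMod c) * y), AddChar.map_nsmul_eq_pow]
  rw [geom_sum_eq hne, hpow, sub_self, zero_div]

/-- A weight modulo `q` that vanishes at the stationary points `m x = n x⁻¹` modulo `q` has
vanishing Kloosterman sum to any modulus `c = q d` with `q ∣ d`. -/
lemma sum_mul_eZMod_eq_zero {q d c : ℕ} [NeZero c] (hc : c = q * d) (hqd : q ∣ d) (hq : q ∣ c)
    (m n : ZMod c) (w : ZMod q → ℂ)
    (hw : ∀ x : (ZMod c)ˣ,
      ZMod.castHom hq (ZMod q) (m * (x : ZMod c) - n * ((x⁻¹ : (ZMod c)ˣ) : ZMod c)) = 0 →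
        w (ZMod.castHom hq (ZMod q) (x : ZMod c)) = 0) :
    ∑ x : (ZMod c)ˣ, w (ZMod.castHom hq (ZMod q) (x : ZMod c)) *
      eZMod c (m * (x : ZMod c) + n * ((x⁻¹ : (ZMod c)ˣ) : ZMod c)) = 0 := by
  simp_rw [eZMod_eq_stdAddChar]
  have hdd : (d : ZMod c) * d = 0 := by
    rw [← Nat.cast_mul, ZMod.natCast_eq_zero_iff, hc]
    exact Nat.mul_dvd_mul_right hqd d
  have hdq : (d : ZMod q) = 0 := (ZMod.natCast_eq_zero_iff d q).2 hqd
  let u (t : ℕ) : (ZMod c)ˣ :=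
    ⟨1 + t * d, 1 - t * d, by linear_combination (-(t : ZMod c) ^ 2) * hdd,
      by linear_combination (-(t : ZMod c) ^ 2) * hdd⟩
  have huv (t : ℕ) : ((u t : (ZMod c)ˣ) : ZMod c) = 1 + t * d := rfl
  have hui (t : ℕ) : (((u t)⁻¹ : (ZMod c)ˣ) : ZMod c) = 1 - t * d := rfl
  set S := ∑ x : (ZMod c)ˣ, w (ZMod.castHom hq (ZMod q) (x : ZMod c)) *
      ZMod.stdAddChar (m * (x : ZMod c) + n * ((x⁻¹ : (ZMod c)ˣ) : ZMod c)) with hS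
  have key (t : ℕ) : S = ∑ x : (ZMod c)ˣ, w (ZMod.castHom hq (ZMod q) (x : ZMod c)) *
      ZMod.stdAddChar (m * (x : ZMod c) + n * ((x⁻¹ : (ZMod c)ˣ) : ZMod c)) *
      ZMod.stdAddChar ((t : ZMod c) * ((d : ZMod c) *
        (m * (x : ZMod c) - n * ((x⁻¹ : (ZMod c)ˣ) : ZMod c)))) := by
    rw [hS, ← Equiv.sum_comp (Equiv.mulRight (u t))]
    refine sum_congr rfl fun x _ ↦ ?_
    rw [mul_assoc, ← AddChar.map_add_eq_mul, Equiv.coe_mulRight, mul_inv_rev, Units.val_mul,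
      Units.val_mul, huv, hui]
    congr 2
    · simp only [map_mul, map_add, map_one, map_natCast, hdq, mul_zero, add_zero, mul_one]
    · ring
  have hsum : (q : ℂ) * S = 0 := by
    calc (q : ℂ) * S = ∑ _t ∈ range q, S := by simp
      _ = _ := sum_congr rfl fun t _ ↦ key t
      _ = 0 := by
        rw [sum_comm]
        refine sum_eq_zero fun x _ ↦ ?_
        rw [← mul_sum]
        by_cases h : ZMod.castHom hq (ZMod q)
            (m * (x : ZMod c) - n * ((x⁻¹ : (ZMod c)ˣ) : ZMod c)) = 0
        · rw [hw x h, zero_mul, zero_mul]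
        · rw [sum_stdAddChar_eq_zero hc hq _ h, mul_zero]
  have hq0 : (q : ℂ) ≠ 0 := Nat.cast_ne_zero.2 fun h ↦ NeZero.ne c (by simp [hc, h])
  exact (mul_eq_zero.1 hsum).resolve_left hq0

/-- for `c = b·p^r` with `r ≥ 2k`, the twisted Kloosterman sum
`χ(m) conj(χ(n)) S_{χ̄²}(m,n;c)` collapses to the ordinary Kloosterman sum. -/
theorem SChiSq_eq_klooOrd (p : ℕ) (hp : p.Prime) (hodd : Odd p)
    (k : ℕ) (hk : 1 ≤ k) (b m n : ℕ) (hb : 0 < b) (hm : 0 < m) (hn : 0 < n)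
    (hpb : ¬ p ∣ b) (hpm : ¬ p ∣ m) (hpn : ¬ p ∣ n)
    (χ : DirichletCharacter ℂ (p^k)) (r : ℕ) (hr : 2 * k ≤ r)
    (c : ℕ) [NeZero c] (hc : c = b * p ^ r) (hdvd : p ^ k ∣ c) :
    χ (m : ZMod (p^k)) * (starRingEnd ℂ) (χ (n : ZMod (p^k))) *
        SChiSq (p^k) c hdvd χ (m : ZMod c) (n : ZMod c)
      = klooOrd c (m : ZMod c) (n : ZMod c) := by
  have hpr : p ^ r = p ^ k * p ^ (r - k) := by rw [← pow_add]; congr 1; omega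
  have hcd : c = p ^ k * (b * p ^ (r - k)) := by rw [hc, hpr]; ring
  have hdiv : p ^ k ∣ b * p ^ (r - k) := (pow_dvd_pow p (by omega)).mul_left b
  have hnu : IsUnit (n : ZMod (p ^ k)) :=
    (ZMod.isUnit_iff_coprime n (p ^ k)).2 ((hp.coprime_iff_not_dvd.2 hpn).symm.pow_right k)
  have hχn : χ (n : ZMod (p ^ k)) * (starRingEnd ℂ) (χ (n : ZMod (p ^ k))) = 1 := by
    obtain ⟨v, hv⟩ := hnu
    rw [← hv, Complex.mul_conj', DirichletCharacter.unit_norm_eq_one]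
    simp
  have h := sum_mul_eZMod_eq_zero hcd hdiv hdvd (m : ZMod c) (n : ZMod c)
    (fun a ↦ χ (m : ZMod (p ^ k)) * (starRingEnd ℂ) (χ (n : ZMod (p ^ k))) * χ a ^ 2 - 1) (by
      intro x hx
      rw [map_sub, map_mul, map_mul, map_natCast, map_natCast, sub_eq_zero] at hx
      have hx1 := congrArg χ hx
      rw [map_mul, map_mul] at hx1
      have hx2 : χ (ZMod.castHom hdvd (ZMod (p ^ k)) (x : ZMod c)) *
          χ (ZMod.castHom hdvd (ZMod (p ^ k)) ((x⁻¹ : (ZMod c)ˣ) : ZMod c)) = 1 := by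
        rw [← map_mul, ← map_mul, Units.mul_inv, map_one, map_one]
      linear_combination
        (starRingEnd ℂ) (χ (n : ZMod (p ^ k))) *
          χ (ZMod.castHom hdvd (ZMod (p ^ k)) (x : ZMod c)) * hx1 +
        χ (n : ZMod (p ^ k)) * (starRingEnd ℂ) (χ (n : ZMod (p ^ k))) * hx2 + hχn)
  rw [← sub_eq_zero, ← h, SChiSq, klooOrd, mul_sum, ← sum_sub_distrib]
  exact sum_congr rfl fun x _ ↦ by ring
end

section
/- If m, n are positive integers not divisible by p, and r is an integer with k ≤ r < j + k, then K_ψ^+(m,n;p^r) = 0. -/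
open Complex Finset

/-- The coset sum `σ_{ψ,ε}(m,n;c)`: the sum over the Dirichlet characters `χ` modulo `p^k`
in the coset `ψ·Ĝ_{p^j}` of `χ(m)·conj(χ(n))·(1 + ε·χ(-1))·S_{χ̄²}(m,n;c)`. -/
noncomputable def cosetSum (p k j : ℕ) (hjk : j ≤ k) (ψ : DirichletCharacter ℂ (p^k))
    (ε : ℤ) (c : ℕ) [NeZero c] (hqc : p^k ∣ c) (m n : ZMod c) : ℂ :=
  ∑ χ' : DirichletCharacter ℂ (p^j),
    (ψ * DirichletCharacter.changeLevel (pow_dvd_pow p hjk) χ')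
        (ZMod.castHom hqc (ZMod (p^k)) m) *
    (starRingEnd ℂ) ((ψ * DirichletCharacter.changeLevel (pow_dvd_pow p hjk) χ')
        (ZMod.castHom hqc (ZMod (p^k)) n)) *
    (1 + (ε : ℂ) * (ψ * DirichletCharacter.changeLevel (pow_dvd_pow p hjk) χ') (-1)) *
    SChiSq (p^k) c hqc (ψ * DirichletCharacter.changeLevel (pow_dvd_pow p hjk) χ') m n

/-- The sums `K_ψ^±(m,n;p^r)` (the sign `±` is the parameter `s`): the sum of
`ψ(x)² e_{p^r}(mx + n x̄)` over `x mod p^r`, `p ∤ x`, with `m x² ≡ s·n (mod p^j)`. -/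
noncomputable def Kpm (p k j r : ℕ) [NeZero (p^r)] (hkr : k ≤ r) (hjr : j ≤ r)
    (ψ : DirichletCharacter ℂ (p^k)) (s : ℤ) (m n : ZMod (p^r)) : ℂ :=
  ∑ x ∈ Finset.univ.filter (fun x : (ZMod (p^r))ˣ =>
      ZMod.castHom (pow_dvd_pow p hjr) (ZMod (p^j)) (m * (x : ZMod (p^r))^2)
        = (s : ZMod (p^j)) * ZMod.castHom (pow_dvd_pow p hjr) (ZMod (p^j)) n),
    (ψ (ZMod.castHom (pow_dvd_pow p hkr) (ZMod (p^k)) (x : ZMod (p^r))))^2 *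
      eZMod (p^r) (m * (x : ZMod (p^r)) + n * ((x⁻¹ : (ZMod (p^r))ˣ) : ZMod (p^r)))

/-- An element of `ZMod N` that reduces to zero modulo `d ∣ N` is a multiple of `d`. -/
lemma ZMod.natCast_dvd_of_castHom_eq_zero {N d : ℕ} [NeZero N] (h : d ∣ N) {z : ZMod N}
    (hz : ZMod.castHom h (ZMod d) z = 0) : (d : ZMod N) ∣ z := by
  rw [← ZMod.natCast_zmod_val z] at hz ⊢
  rw [map_natCast, ZMod.natCast_eq_zero_iff] at hz
  exact Nat.cast_dvd_cast hz

/-- A Dirichlet character of conductor `N` is nontrivial on the kernel of reduction modulo any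
proper divisor `d` of `N`. -/
lemma DirichletCharacter.exists_unitsMap_eq_one_and_apply_ne_one {R : Type*}
    [CommMonoidWithZero R] {N d : ℕ} [NeZero N] (χ : DirichletCharacter R N)
    (hχ : χ.conductor = N) (hd : d ∣ N) (hdN : d < N) :
    ∃ g : (ZMod N)ˣ, ZMod.unitsMap hd g = 1 ∧ χ g ≠ 1 := by
  by_contra! H
  have hf : χ.FactorsThrough d := by
    rw [DirichletCharacter.factorsThrough_iff_ker_unitsMap hd]
    intro g hg
    rw [MonoidHom.mem_ker] at hg ⊢
    ext
    rw [MulChar.coe_toUnitHom, H g hg, Units.val_one]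
  exact (Nat.sInf_le hf).not_gt (show d < χ.conductor from hχ.symm ▸ hdN)

/-- Multiplying `x` by `g ≡ 1 (mod P)` does not change `m x + n x⁻¹` if `P ^ 2 = 0` and `P`
annihilates `m x ^ 2 - n`. -/
lemma Units.mul_add_mul_inv_mul_eq {R : Type*} [CommRing R] {m n P : R} {x g : Rˣ}
    (hPP : P * P = 0) (hg : P ∣ (g : R) - 1) (hx : P * (m * (x : R) ^ 2 - n) = 0) :
    m * ((g * x : Rˣ) : R) + n * (((g * x)⁻¹ : Rˣ) : R)
      = m * (x : R) + n * ((x⁻¹ : Rˣ) : R) := by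
  obtain ⟨u, hu⟩ := hg
  have hgi : (g : R) * ((g⁻¹ : Rˣ) : R) = 1 := g.mul_inv
  have hxi : (x : R) * ((x⁻¹ : Rˣ) : R) = 1 := x.mul_inv
  rw [_root_.mul_inv, Units.val_mul, Units.val_mul]
  generalize ((g⁻¹ : Rˣ) : R) = h at *
  generalize ((x⁻¹ : Rˣ) : R) = y at *
  generalize (g : R) = g at *
  generalize (x : R) = x at *
  have hh : h = 1 - P * u := by
    linear_combination (1 - P * u) * hgi - h * (1 - P * u) * hu + h * u ^ 2 * hPP
  rw [hh]
  linear_combination m * x * hu + u * y * hx - P * u * m * x * hxi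

/-- the same-sign sum `K_ψ^+(m,n;p^r)` vanishes for `k ≤ r < j + k`. -/
theorem Kplus_eq_zero (p : ℕ) (hp : p.Prime) (hodd : Odd p)
    (k : ℕ) (hk : 2 ≤ k) (j : ℕ) (hj : 1 ≤ j) (hjk : j < k)
    (ψ : DirichletCharacter ℂ (p^k)) (hψ : (ψ^2).conductor = p^k)
    (m n : ℕ) (hm : 0 < m) (hn : 0 < n) (hpm : ¬ p ∣ m) (hpn : ¬ p ∣ n)
    (r : ℕ) (hkr : k ≤ r) (hrjk : r < j + k) [NeZero (p^r)] :
    Kpm p k j r hkr (le_of_lt (lt_of_lt_of_le hjk hkr)) ψ 1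
        (m : ZMod (p^r)) (n : ZMod (p^r)) = 0 := by
  have : NeZero (p ^ k) := ⟨pow_ne_zero k hp.ne_zero⟩
  obtain ⟨g₀, hg₀, hψg₀⟩ :=
    (ψ ^ 2).exists_unitsMap_eq_one_and_apply_ne_one hψ (pow_dvd_pow p (Nat.sub_le k 1))
      (Nat.pow_lt_pow_right hp.one_lt (by omega))
  obtain ⟨g, rfl⟩ := ZMod.unitsMap_surjective (pow_dvd_pow p hkr) g₀
  have hgψ :
      ψ (ZMod.castHom (pow_dvd_pow p hkr) (ZMod (p ^ k)) (g : ZMod (p ^ r))) ^ 2 ≠ 1 := by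
    rw [← MulChar.pow_apply' _ two_ne_zero]
    exact hψg₀
  have hg : ((p ^ (k - 1) : ℕ) : ZMod (p ^ r)) ∣ (g : ZMod (p ^ r)) - 1 := by
    apply ZMod.natCast_dvd_of_castHom_eq_zero (pow_dvd_pow p (by omega))
    rw [map_sub, map_one, sub_eq_zero]
    rw [← MonoidHom.comp_apply, ZMod.unitsMap_comp] at hg₀
    exact congrArg Units.val hg₀
  have hzero : ∀ a b, r ≤ a + b →
      ((p ^ a : ℕ) : ZMod (p ^ r)) * ((p ^ b : ℕ) : ZMod (p ^ r)) = 0 := by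
    intro a b hab
    rw [← Nat.cast_mul, ← pow_add, ZMod.natCast_eq_zero_iff]
    exact pow_dvd_pow p hab
  have hgj : ZMod.castHom (pow_dvd_pow p (hjk.le.trans hkr)) (ZMod (p ^ j))
      (g : ZMod (p ^ r)) = 1 := by
    obtain ⟨u, hu⟩ := hg
    rw [sub_eq_iff_eq_add.mp hu, map_add, map_one, map_mul, map_natCast,
      (ZMod.natCast_eq_zero_iff _ _).mpr (pow_dvd_pow p (by omega)), zero_mul, zero_add]
  rw [← mul_right_eq_self₀.trans (or_iff_right hgψ), Kpm, Finset.sum_mul]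
  refine Finset.sum_equiv (Equiv.mulLeft g) (fun x => ?_) (fun x hx => ?_)
  · simp only [Finset.mem_filter, Finset.mem_univ, true_and, Equiv.coe_mulLeft, Units.val_mul,
      map_mul, map_pow, hgj, one_mul]
  · rw [Finset.mem_filter] at hx
    have hxj := hx.2
    rw [Int.cast_one, one_mul, ← sub_eq_zero, ← map_sub] at hxj
    obtain ⟨v, hv⟩ := ZMod.natCast_dvd_of_castHom_eq_zero _ hxj
    rw [Equiv.coe_mulLeft, Units.mul_add_mul_inv_mul_eq (hzero (k - 1) (k - 1) (by omega)) hg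
      (by rw [hv, ← mul_assoc, hzero (k - 1) j (by omega), zero_mul]), Units.val_mul, map_mul,
      map_mul, mul_pow]
    ring
end

section
/- If m, n are positive integers not divisible by p, and r is an integer with r > k, then K_ψ^−(m,n;p^r) = 0. -/
open Complex Finset

/-- Translation of units by an element of square zero. -/
def unitsShift {R : Type*} [CommRing R] (a : R) (ha : a ^ 2 = 0) : Rˣ ≃ Rˣ where
  toFun x := ⟨x + a, ↑x⁻¹ - a * (↑x⁻¹ : R) ^ 2,
    by linear_combination (1 - a * (↑x⁻¹ : R)) * x.mul_inv - (↑x⁻¹ : R) ^ 2 * ha,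
    by linear_combination (1 - a * (↑x⁻¹ : R)) * x.mul_inv - (↑x⁻¹ : R) ^ 2 * ha⟩
  invFun x := ⟨x - a, ↑x⁻¹ + a * (↑x⁻¹ : R) ^ 2,
    by linear_combination (1 + a * (↑x⁻¹ : R)) * x.mul_inv - (↑x⁻¹ : R) ^ 2 * ha,
    by linear_combination (1 + a * (↑x⁻¹ : R)) * x.mul_inv - (↑x⁻¹ : R) ^ 2 * ha⟩
  left_inv x := by ext; simp
  right_inv x := by ext; simp

lemma coe_unitsShift {R : Type*} [CommRing R] (a : R) (ha : a ^ 2 = 0) (x : Rˣ) :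
    (unitsShift a ha x : R) = x + a := rfl

lemma coe_inv_unitsShift {R : Type*} [CommRing R] (a : R) (ha : a ^ 2 = 0) (x : Rˣ) :
    (↑(unitsShift a ha x)⁻¹ : R) = ↑x⁻¹ - a * (↑x⁻¹ : R) ^ 2 := rfl

lemma ZMod.dvd_of_castHom_eq_zero {a b : ℕ} [NeZero b] (h : a ∣ b) {z : ZMod b}
    (hz : ZMod.castHom h (ZMod a) z = 0) : (a : ZMod b) ∣ z := by
  rw [← ZMod.natCast_zmod_val z, map_natCast, ZMod.natCast_eq_zero_iff] at hz
  rw [← ZMod.natCast_zmod_val z]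
  exact Nat.cast_dvd_cast hz

/-- the opposite-sign sum `K_ψ^-(m,n;p^r)` vanishes for `r > k`. -/
theorem Kminus_eq_zero (p : ℕ) (hp : p.Prime) (hodd : Odd p)
    (k : ℕ) (hk : 2 ≤ k) (j : ℕ) (hj : 1 ≤ j) (hjk : j < k)
    (ψ : DirichletCharacter ℂ (p^k)) (hψ : (ψ^2).conductor = p^k)
    (m n : ℕ) (hm : 0 < m) (hn : 0 < n) (hpm : ¬ p ∣ m) (hpn : ¬ p ∣ n)
    (r : ℕ) (hkr : k < r) [NeZero (p^r)] :
    Kpm p k j r hkr.le (le_of_lt (lt_of_lt_of_le hjk hkr.le)) ψ (-1)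
        (m : ZMod (p^r)) (n : ZMod (p^r)) = 0 := by
  set P : ZMod (p ^ r) := (p : ZMod (p ^ r)) ^ (r - 1) with hP
  have hPp : P * p = 0 := by
    rw [hP, ← pow_succ, Nat.sub_add_cancel (by lia), ← Nat.cast_pow, ZMod.natCast_self]
  have hP2 : P ^ 2 = 0 := by
    have h : P = p * (p : ZMod (p ^ r)) ^ (r - 2) := by
      rw [hP, ← pow_succ']
      congr 1
      lia
    rw [sq]
    nth_rw 2 [h]
    rw [← mul_assoc, hPp, zero_mul]
  have hcast {i : ℕ} (hi : i < r) :
      ZMod.castHom (pow_dvd_pow p hi.le) (ZMod (p ^ i)) P = 0 := by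
    rw [hP, map_pow, map_natCast, ← Nat.cast_pow, ZMod.natCast_eq_zero_iff]
    exact pow_dvd_pow p (by lia)
  have hne : (ZMod.stdAddChar (P * (2 * (m : ZMod (p ^ r)))) : ℂ) ≠ 1 := by
    rw [← AddChar.map_zero_eq_one (ZMod.stdAddChar (N := p ^ r)),
      ZMod.injective_stdAddChar.ne_iff]
    intro h
    have h' : ((p ^ (r - 1) * (2 * m) : ℕ) : ZMod (p ^ r)) = 0 := by
      push_cast
      exact h
    rw [ZMod.natCast_eq_zero_iff] at h'
    have hr : p ^ r = p ^ (r - 1) * p := by rw [← pow_succ, Nat.sub_add_cancel (by lia)]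
    nth_rw 1 [hr] at h'
    have h2 := Nat.dvd_of_mul_dvd_mul_left (pow_pos hp.pos _) h'
    rcases hp.dvd_mul.1 h2 with h2 | h2
    · rw [Nat.prime_dvd_prime_iff_eq hp Nat.prime_two] at h2
      subst h2
      exact absurd hodd (by decide)
    · exact hpm h2
  have hkey : Kpm p k j r hkr.le (le_of_lt (lt_of_lt_of_le hjk hkr.le)) ψ (-1)
        (m : ZMod (p^r)) (n : ZMod (p^r)) * ZMod.stdAddChar (P * (2 * (m : ZMod (p ^ r)))) =
      Kpm p k j r hkr.le (le_of_lt (lt_of_lt_of_le hjk hkr.le)) ψ (-1)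
        (m : ZMod (p^r)) (n : ZMod (p^r)) := by
    unfold Kpm
    rw [Finset.sum_mul]
    refine Finset.sum_equiv (unitsShift P hP2) (fun x => ?_) (fun x hx => ?_)
    · simp only [Finset.mem_filter, Finset.mem_univ, true_and, coe_unitsShift, map_mul, map_pow,
        map_add, hcast (hjk.trans hkr), add_zero]
    · rw [Finset.mem_filter] at hx
      have hdvd : ((p ^ j : ℕ) : ZMod (p ^ r)) ∣ m * (x : ZMod (p ^ r)) ^ 2 + n := by
        refine ZMod.dvd_of_castHom_eq_zero (pow_dvd_pow p (hjk.trans hkr).le) ?_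
        rw [map_add, hx.2]
        push_cast
        ring
      rw [Nat.cast_pow] at hdvd
      obtain ⟨y, hy⟩ := (dvd_pow_self (p : ZMod (p ^ r)) (by lia : j ≠ 0)).trans hdvd
      rw [coe_unitsShift, coe_inv_unitsShift, map_add, hcast hkr, add_zero, mul_assoc]
      congr 1
      rw [eZMod_eq_stdAddChar, eZMod_eq_stdAddChar, ← AddChar.map_add_eq_mul]
      congr 1
      linear_combination P * (↑x⁻¹ : ZMod (p ^ r)) ^ 2 * hy + (↑x⁻¹ : ZMod (p ^ r)) ^ 2 * y * hPp
        - P * m * (x * (↑x⁻¹ : ZMod (p ^ r)) + 1) * x.mul_inv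
  exact (mul_right_eq_self₀.1 hkey).resolve_left hne
end

section
/- If m, n are positive integers not divisible by p, and r is an integer with r ≥ j + k, then K_ψ^+(m,n;p^r) = S_{ψ̄²}(m,n;p^r). -/
open Complex Finset

/-- Multiplication by `p ^ (r - j)` on `ZMod (p ^ r)` kills exactly the multiples of `p ^ j`. -/
lemma ZMod.pow_sub_mul_eq_zero_iff {p r j : ℕ} (hp : 0 < p) [NeZero (p ^ r)] (hjr : j ≤ r)
    (y : ZMod (p ^ r)) :
    y * (p : ZMod (p ^ r)) ^ (r - j) = 0 ↔
      ZMod.castHom (pow_dvd_pow p hjr) (ZMod (p ^ j)) y = 0 := by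
  obtain ⟨Y, rfl⟩ := ZMod.natCast_zmod_surjective y
  rw [map_natCast, ZMod.natCast_eq_zero_iff, ← Nat.cast_pow, ← Nat.cast_mul,
    ZMod.natCast_eq_zero_iff]
  conv_lhs => rw [← Nat.add_sub_cancel' hjr, pow_add, Nat.add_sub_cancel_left]
  exact Nat.mul_dvd_mul_iff_right (pow_pos hp _)

/-- For `d` with `d ^ 2 = 0`, the unit `1 + d * t`, with inverse `1 - d * t`. -/
def unitOneAddMul {R : Type*} [CommRing R] {d : R} (hd : d ^ 2 = 0) (t : R) : Rˣ where
  val := 1 + d * t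
  inv := 1 - d * t
  val_inv := by linear_combination -t ^ 2 * hd
  inv_val := by linear_combination -t ^ 2 * hd

/-- Averaging a sum over the units of `R` over the translates by `1 + d * t` restricts it to
the units on which the resulting linear phase is trivial. -/
lemma sum_units_eq_sum_filter {R : Type*} [CommRing R] [Fintype R] [DecidableEq R]
    {e : AddChar R ℂ} (he : e.IsPrimitive) {d : R} (hd : d ^ 2 = 0) (m n : R)
    (f : Rˣ → ℂ) (hf : ∀ x t, f (x * unitOneAddMul hd t) = f x) :
    ∑ x : Rˣ, f x * e (m * x + n * (x⁻¹ : Rˣ)) =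
      ∑ x : Rˣ with (m * x - n * (x⁻¹ : Rˣ)) * d = 0, f x * e (m * x + n * (x⁻¹ : Rˣ)) := by
  have h_shift (t : R) : ∑ x : Rˣ, f x * e (m * x + n * (x⁻¹ : Rˣ)) =
      ∑ x : Rˣ, f x * e (m * x + n * (x⁻¹ : Rˣ)) *
        e (t * ((m * x - n * (x⁻¹ : Rˣ)) * d)) := by
    rw [← Equiv.sum_comp (Equiv.mulRight (unitOneAddMul hd t))]
    refine Finset.sum_congr rfl fun x _ => ?_
    rw [Equiv.coe_mulRight, hf, mul_assoc, ← AddChar.map_add_eq_mul]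
    congr 2
    rw [mul_inv, Units.val_mul, Units.val_mul]
    change m * (x * (1 + d * t)) + n * ((x⁻¹ : Rˣ) * (1 - d * t)) = _
    ring
  have h_card : (Fintype.card R : ℂ) ≠ 0 := Nat.cast_ne_zero.mpr Fintype.card_ne_zero
  refine mul_left_cancel₀ h_card ?_
  calc
    _ = ∑ t : R, ∑ x : Rˣ, f x * e (m * x + n * (x⁻¹ : Rˣ)) *
        e (t * ((m * x - n * (x⁻¹ : Rˣ)) * d)) := by
      rw [← Finset.sum_congr rfl fun t _ => h_shift t, Finset.sum_const, nsmul_eq_mul,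
        Finset.card_univ]
    _ = _ := by
      rw [Finset.sum_comm, Finset.sum_filter, Finset.mul_sum]
      refine Finset.sum_congr rfl fun x _ => ?_
      rw [← Finset.mul_sum, AddChar.sum_mulShift _ he]
      split_ifs <;> simp [mul_comm]

/-- for `r ≥ j + k`, the same-sign sum `K_ψ^+(m,n;p^r)` equals the twisted
Kloosterman sum `S_{ψ̄²}(m,n;p^r)`. -/
theorem Kplus_eq_SChiSq (p : ℕ) (hp : p.Prime) (hodd : Odd p)
    (k : ℕ) (hk : 2 ≤ k) (j : ℕ) (hj : 1 ≤ j) (hjk : j < k)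
    (ψ : DirichletCharacter ℂ (p^k)) (hψ : (ψ^2).conductor = p^k)
    (m n : ℕ) (hm : 0 < m) (hn : 0 < n) (hpm : ¬ p ∣ m) (hpn : ¬ p ∣ n)
    (r : ℕ) (hr : j + k ≤ r) [NeZero (p^r)] :
    Kpm p k j r (le_trans (Nat.le_add_left k j) hr) (le_trans (Nat.le_add_right j k) hr)
        ψ 1 (m : ZMod (p^r)) (n : ZMod (p^r))
      = SChiSq (p^k) (p^r) (pow_dvd_pow p (le_trans (Nat.le_add_left k j) hr)) ψ
          (m : ZMod (p^r)) (n : ZMod (p^r)) := by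
  have hkr : k ≤ r := le_trans (Nat.le_add_left k j) hr
  have hjr : j ≤ r := le_trans (Nat.le_add_right j k) hr
  have hd : ((p : ZMod (p ^ r)) ^ (r - j)) ^ 2 = 0 := by
    rw [← pow_mul, ← Nat.cast_pow, ZMod.natCast_eq_zero_iff]
    exact pow_dvd_pow p (by omega)
  have hdk : ZMod.castHom (pow_dvd_pow p hkr) (ZMod (p ^ k)) ((p : ZMod (p ^ r)) ^ (r - j)) = 0 := by
    rw [← Nat.cast_pow, map_natCast, ZMod.natCast_eq_zero_iff]
    exact pow_dvd_pow p (by omega)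
  simp only [Kpm, SChiSq, eZMod_eq_stdAddChar]
  rw [sum_units_eq_sum_filter (ZMod.isPrimitive_stdAddChar _) hd (m : ZMod (p ^ r)) n
    (fun x => (ψ (ZMod.castHom (pow_dvd_pow p hkr) (ZMod (p ^ k)) (x : ZMod (p ^ r)))) ^ 2)]
  · refine Finset.sum_congr (Finset.filter_congr fun x _ => ?_) fun _ _ => rfl
    have h_factor : (m : ZMod (p ^ r)) * x ^ 2 - n =
        (m * x - n * (x⁻¹ : (ZMod (p ^ r))ˣ)) * x := by
      linear_combination (n : ZMod (p ^ r)) * x.inv_mul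
    rw [ZMod.pow_sub_mul_eq_zero_iff hp.pos hjr, Int.cast_one, one_mul, ← sub_eq_zero, ← map_sub,
      h_factor, map_mul,
      (x.isUnit.map (ZMod.castHom (pow_dvd_pow p hjr) (ZMod (p ^ j)))).mul_left_eq_zero]
  · intro x t
    have h_unit : ((unitOneAddMul hd t : (ZMod (p ^ r))ˣ) : ZMod (p ^ r)) =
        1 + (p : ZMod (p ^ r)) ^ (r - j) * t := rfl
    simp only [Units.val_mul, h_unit, map_mul, map_add, map_one, hdk, zero_mul, add_zero, mul_one]
end

section
/- Let b be a positive integer not divisible by p and let c = b·q. If η is a Dirichlet character modulo c such that p^{k−j+1} divides the conductor of η², then ∑_{m mod c, gcd(m,c)=1} η(m)·σ_{ψ,ε}(m,1;c) = 0. -/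
open Complex Finset

theorem sum_eq_zero_of_apply_equiv_eq_mul {α : Type*} [Fintype α] (σ : α ≃ α) (f : α → ℂ)
    {w : ℂ} (hw : w ≠ 1) (h : ∀ i, f (σ i) = w * f i) : ∑ i, f i = 0 := by
  refine eq_zero_of_mul_eq_self_left hw ?_
  rw [Finset.mul_sum, ← Equiv.sum_comp σ f]
  exact Finset.sum_congr rfl fun i _ ↦ (h i).symm

theorem ZMod.mul_eq_zero_of_castHom_eq_zero {c d l : ℕ} (hd : d ∣ c) (hl : l ∣ c) (h : c ∣ d * l)
    {x y : ZMod c} (hx : ZMod.castHom hd (ZMod d) x = 0) (hy : ZMod.castHom hl (ZMod l) y = 0) :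
    x * y = 0 := by
  obtain ⟨x, rfl⟩ := ZMod.intCast_surjective x
  obtain ⟨y, rfl⟩ := ZMod.intCast_surjective y
  rw [map_intCast, ZMod.intCast_zmod_eq_zero_iff_dvd] at hx hy
  rw [← Int.cast_mul, ZMod.intCast_zmod_eq_zero_iff_dvd]
  exact (Int.natCast_dvd_natCast.mpr h).trans (by push_cast; exact mul_dvd_mul hx hy)

theorem ZMod.castHom_units_eq_one {c d : ℕ} (hd : d ∣ c) {u : (ZMod c)ˣ}
    (hu : ZMod.unitsMap hd u = 1) : ZMod.castHom hd (ZMod d) u = 1 :=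
  congrArg Units.val hu

theorem DirichletCharacter.exists_unitsMap_eq_one_apply_ne_one {c d : ℕ} [NeZero c]
    (χ : DirichletCharacter ℂ c) (hd : d ∣ c) (h : ¬ χ.conductor ∣ d) :
    ∃ u : (ZMod c)ˣ, ZMod.unitsMap hd u = 1 ∧ χ u ≠ 1 := by
  by_contra! H
  refine h (conductor_dvd_of_mem_conductorSet χ ((factorsThrough_iff_ker_unitsMap hd).mpr ?_))
  intro u hu
  rw [MonoidHom.mem_ker, Units.ext_iff, MulChar.coe_toUnitHom, Units.val_one]
  exact H u hu

/-- The part of the coset sum supported on `m x² ≡ 1` vanishes for every single `m`. -/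
theorem sum_unitsMap_eq_one_eq_zero {c d l : ℕ} [NeZero c] (hd : d ∣ c) (hl : l ∣ c)
    (hld : l ∣ d) (hcd : c ∣ d * l) (χ : DirichletCharacter ℂ c)
    (hχ : ¬ (χ ^ 2).conductor ∣ d) (m : (ZMod c)ˣ) :
    ∑ x : (ZMod c)ˣ, χ ((m * x ^ 2 : (ZMod c)ˣ) : ZMod c) *
      (if ZMod.unitsMap hl (m * x ^ 2) = 1 then 1 else 0) *
      eZMod c ((m : ZMod c) * x + (x⁻¹ : (ZMod c)ˣ)) = 0 := by
  obtain ⟨u, hu, hχu⟩ := (χ ^ 2).exists_unitsMap_eq_one_apply_ne_one hd hχ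
  have hul : ZMod.unitsMap hl u = 1 := by
    rw [← ZMod.unitsMap_comp hld hd, MonoidHom.comp_apply, hu, map_one]
  refine sum_eq_zero_of_apply_equiv_eq_mul (Equiv.mulLeft u) _ hχu fun x ↦ ?_
  have hmap : ZMod.unitsMap hl (m * (u * x) ^ 2) = ZMod.unitsMap hl (m * x ^ 2) := by
    simp [hul]
  rw [Equiv.coe_mulLeft, hmap]
  split_ifs with h1
  · have harg : (m : ZMod c) * ((u * x : (ZMod c)ˣ) : ZMod c) + ((u * x)⁻¹ : (ZMod c)ˣ)
        = (m : ZMod c) * x + (x⁻¹ : (ZMod c)ˣ) := by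
      have h0 : ((u : ZMod c) - 1) * (m * x - (u⁻¹ : (ZMod c)ˣ) * (x⁻¹ : (ZMod c)ˣ)) = 0 := by
        refine ZMod.mul_eq_zero_of_castHom_eq_zero hd hl hcd ?_ ?_
        · rw [map_sub, map_one, ZMod.castHom_units_eq_one hd hu, sub_self]
        · have h2 : ZMod.unitsMap hl (m * x) = ZMod.unitsMap hl (u⁻¹ * x⁻¹) := by
            rw [map_mul _ u⁻¹, map_inv, hul, inv_one, one_mul, map_inv, eq_inv_iff_mul_eq_one,
              ← map_mul, mul_assoc, ← pow_two, h1]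
          rw [map_sub, sub_eq_zero]
          exact congrArg Units.val h2
      have huu : (u : ZMod c) * (u⁻¹ : (ZMod c)ˣ) = 1 := u.mul_inv
      rw [mul_inv]
      push_cast
      linear_combination h0 + (x⁻¹ : (ZMod c)ˣ) * huu
    rw [harg]
    simp only [Units.val_mul, Units.val_pow_eq_pow_val, map_mul, map_pow, MulChar.pow_apply_coe]
    ring
  · simp

/-- The part of the coset sum supported on `m x² ≡ -1` has no Fourier coefficient at `η`. -/
theorem sum_unitsMap_neg_eq_one_eq_zero {c d l : ℕ} [NeZero c] (hd : d ∣ c) (hl : l ∣ c)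
    (hcd : c ∣ d * l) (χ η : DirichletCharacter ℂ c) (hη : ¬ (η ^ 2).conductor ∣ d) :
    ∑ m : (ZMod c)ˣ, ∑ x : (ZMod c)ˣ, η m * (χ ((m * x ^ 2 : (ZMod c)ˣ) : ZMod c) *
      (if -ZMod.unitsMap hl (m * x ^ 2) = 1 then 1 else 0) *
      eZMod c ((m : ZMod c) * x + (x⁻¹ : (ZMod c)ˣ))) = 0 := by
  obtain ⟨u, hu, hηu⟩ := (η ^ 2).exists_unitsMap_eq_one_apply_ne_one hd hη
  rw [← Fintype.sum_prod_type']
  refine sum_eq_zero_of_apply_equiv_eq_mul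
    ((Equiv.mulLeft (u ^ 2)).prodCongr (Equiv.mulLeft u⁻¹)) _ hηu fun ⟨m, x⟩ ↦ ?_
  simp only [Equiv.prodCongr_apply, Prod.map_apply, Equiv.coe_mulLeft]
  have hmx : u ^ 2 * m * (u⁻¹ * x) ^ 2 = m * x ^ 2 := by
    rw [mul_pow, mul_mul_mul_comm, ← mul_pow, mul_inv_cancel, one_pow, one_mul]
  rw [hmx]
  split_ifs with h1
  · have harg : ((u ^ 2 * m : (ZMod c)ˣ) : ZMod c) * ((u⁻¹ * x : (ZMod c)ˣ) : ZMod c)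
        + ((u⁻¹ * x)⁻¹ : (ZMod c)ˣ) = (m : ZMod c) * x + (x⁻¹ : (ZMod c)ˣ) := by
      have hxx : (x : ZMod c) * (x⁻¹ : (ZMod c)ˣ) = 1 := x.mul_inv
      have h0 : ((u : ZMod c) - 1) * (m * x + (x⁻¹ : (ZMod c)ˣ)) = 0 := by
        refine ZMod.mul_eq_zero_of_castHom_eq_zero hd hl hcd ?_ ?_
        · rw [map_sub, map_one, ZMod.castHom_units_eq_one hd hu, sub_self]
        · have h2 : ZMod.castHom hl (ZMod l) (m * x ^ 2) = -1 := by
            have := congrArg Units.val (neg_eq_iff_eq_neg.mp h1)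
            rw [Units.val_neg, Units.val_one] at this
            rw [← this, ZMod.unitsMap_def, Units.coe_map]
            simp only [Units.val_mul, Units.val_pow_eq_pow_val, MonoidHom.coe_coe]
          have h3 : (m : ZMod c) * x + (x⁻¹ : (ZMod c)ˣ)
              = (x⁻¹ : (ZMod c)ˣ) * (m * x ^ 2 + 1) := by
            linear_combination -(m * x : ZMod c) * hxx
          rw [h3, map_mul, map_add, h2, map_one, neg_add_cancel, mul_zero]
      have huu : (u : ZMod c) * (u⁻¹ : (ZMod c)ˣ) = 1 := u.mul_inv
      rw [mul_inv, inv_inv]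
      push_cast
      linear_combination h0 + (u * m * x : ZMod c) * huu
    rw [harg]
    simp only [Units.val_mul, Units.val_pow_eq_pow_val, map_mul, map_pow, MulChar.pow_apply_coe]
    ring
  · simp

/-- Orthogonality of the characters modulo `p ^ j` evaluates the coset sum. -/
theorem cosetSum_units_one (p k j : ℕ) (hp : p ≠ 0) (hjk : j ≤ k)
    (ψ : DirichletCharacter ℂ (p ^ k)) (ε : ℤ) (c : ℕ) [NeZero c] (hqc : p ^ k ∣ c)
    (hl : p ^ j ∣ c) (m : (ZMod c)ˣ) :
    cosetSum p k j hjk ψ ε c hqc (m : ZMod c) 1 =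
      ((p ^ j).totient : ℂ) * ∑ x : (ZMod c)ˣ,
          DirichletCharacter.changeLevel hqc ψ ((m * x ^ 2 : (ZMod c)ˣ) : ZMod c) *
          (if ZMod.unitsMap hl (m * x ^ 2) = 1 then 1 else 0) *
          eZMod c ((m : ZMod c) * x + (x⁻¹ : (ZMod c)ˣ)) +
      ((p ^ j).totient : ℂ) * (ε * ψ (-1)) * ∑ x : (ZMod c)ˣ,
          DirichletCharacter.changeLevel hqc ψ ((m * x ^ 2 : (ZMod c)ˣ) : ZMod c) *
          (if -ZMod.unitsMap hl (m * x ^ 2) = 1 then 1 else 0) *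
          eZMod c ((m : ZMod c) * x + (x⁻¹ : (ZMod c)ˣ)) := by
  have : NeZero (p ^ j) := ⟨pow_ne_zero j hp⟩
  have horth (a : (ZMod (p ^ j))ˣ) : ∑ χ : DirichletCharacter ℂ (p ^ j), χ a =
      ((p ^ j).totient : ℂ) * (if a = 1 then 1 else 0) := by
    rw [DirichletCharacter.sum_characters_eq]
    simp
  have hval (χ' : DirichletCharacter ℂ (p ^ j)) (a : (ZMod c)ˣ) :
      (ψ * DirichletCharacter.changeLevel (pow_dvd_pow p hjk) χ')
        (ZMod.castHom hqc (ZMod (p ^ k)) a) =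
      DirichletCharacter.changeLevel hqc ψ a * χ' (ZMod.unitsMap hl a) := by
    have h1 : ZMod.castHom hqc (ZMod (p ^ k)) a = (ZMod.unitsMap hqc a : (ZMod (p ^ k))ˣ) := rfl
    have h2 : ZMod.unitsMap hl a = ZMod.unitsMap (pow_dvd_pow p hjk) (ZMod.unitsMap hqc a) := by
      rw [← ZMod.unitsMap_comp (pow_dvd_pow p hjk) hqc, MonoidHom.comp_apply]
    rw [h1, MulChar.mul_apply, h2]
    simp [DirichletCharacter.changeLevel_def]
  have hneg (χ' : DirichletCharacter ℂ (p ^ j)) :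
      (ψ * DirichletCharacter.changeLevel (pow_dvd_pow p hjk) χ') (-1) = ψ (-1) * χ' (-1) := by
    have h1 : (-1 : ZMod (p ^ k)) = ((-1 : (ZMod (p ^ k))ˣ) : ZMod (p ^ k)) := by simp
    rw [MulChar.mul_apply, h1, DirichletCharacter.changeLevel_eq_cast_of_dvd, ← h1]
    congr 2
    exact (map_neg (ZMod.castHom (pow_dvd_pow p hjk) (ZMod (p ^ j))) 1).trans
      (congrArg Neg.neg (map_one _))
  have hterm (χ' : DirichletCharacter ℂ (p ^ j)) (x : (ZMod c)ˣ) :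
      (ψ * DirichletCharacter.changeLevel (pow_dvd_pow p hjk) χ')
        (ZMod.castHom hqc (ZMod (p ^ k)) m) *
      (ψ * DirichletCharacter.changeLevel (pow_dvd_pow p hjk) χ')
        (ZMod.castHom hqc (ZMod (p ^ k)) x) ^ 2 * (1 + ε * (ψ (-1) * χ' (-1))) =
      DirichletCharacter.changeLevel hqc ψ ((m * x ^ 2 : (ZMod c)ˣ) : ZMod c) *
        (χ' (ZMod.unitsMap hl (m * x ^ 2)) +
          ε * ψ (-1) * χ' ((-ZMod.unitsMap hl (m * x ^ 2) : (ZMod (p ^ j))ˣ) : ZMod (p ^ j))) := by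
    rw [hval, hval, Units.val_neg, ← neg_one_mul (ZMod.unitsMap hl (m * x ^ 2) : ZMod (p ^ j))]
    simp only [Units.val_mul, Units.val_pow_eq_pow_val, map_mul, map_pow]
    ring
  have hsum (x : (ZMod c)ˣ) :
      ∑ χ' : DirichletCharacter ℂ (p ^ j), (χ' (ZMod.unitsMap hl (m * x ^ 2)) +
          ε * ψ (-1) * χ' ((-ZMod.unitsMap hl (m * x ^ 2) : (ZMod (p ^ j))ˣ) : ZMod (p ^ j)))
      = ((p ^ j).totient : ℂ) * (if ZMod.unitsMap hl (m * x ^ 2) = 1 then 1 else 0) +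
        ε * ψ (-1) * (((p ^ j).totient : ℂ) *
          (if -ZMod.unitsMap hl (m * x ^ 2) = 1 then 1 else 0)) := by
    rw [Finset.sum_add_distrib, ← Finset.mul_sum, horth, horth]
  calc
    cosetSum p k j hjk ψ ε c hqc (m : ZMod c) 1
      = ∑ χ' : DirichletCharacter ℂ (p ^ j), ∑ x : (ZMod c)ˣ,
        DirichletCharacter.changeLevel hqc ψ ((m * x ^ 2 : (ZMod c)ˣ) : ZMod c) *
        (χ' (ZMod.unitsMap hl (m * x ^ 2)) +
          ε * ψ (-1) * χ' ((-ZMod.unitsMap hl (m * x ^ 2) : (ZMod (p ^ j))ˣ) : ZMod (p ^ j))) *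
        eZMod c ((m : ZMod c) * x + (x⁻¹ : (ZMod c)ˣ)) := by
        unfold cosetSum SChiSq
        refine Finset.sum_congr rfl fun χ' _ ↦ ?_
        rw [Finset.mul_sum, hneg]
        refine Finset.sum_congr rfl fun x _ ↦ ?_
        rw [← hterm, map_one, map_one, map_one, one_mul]
        ring
    _ = _ := by
        rw [Finset.sum_comm, Finset.mul_sum, Finset.mul_sum, ← Finset.sum_add_distrib]
        refine Finset.sum_congr rfl fun x _ ↦ ?_
        rw [← Finset.sum_mul, ← Finset.mul_sum, hsum]
        ring

/-- if `p^{k-j+1}` divides the conductor of `η²`, the Fourier coefficient of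
the coset sum at `η` vanishes. -/
theorem fourier_cosetSum_eq_zero (p : ℕ) (hp : p.Prime) (hodd : Odd p)
    (k : ℕ) (hk : 2 ≤ k) (j : ℕ) (hj : 1 ≤ j) (hjk : j < k)
    (ψ : DirichletCharacter ℂ (p^k)) (hψ : (ψ^2).conductor = p^k)
    (ε : ℤ) (hε : ε = 1 ∨ ε = -1)
    (b : ℕ) (hb : 0 < b) (hpb : ¬ p ∣ b)
    (c : ℕ) [NeZero c] (hc : c = b * p ^ k) (hqc : p ^ k ∣ c)
    (η : DirichletCharacter ℂ c) (hcond : p ^ (k - j + 1) ∣ (η^2).conductor) :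
    ∑ m : (ZMod c)ˣ, η (m : ZMod c) * cosetSum p k j hjk.le ψ ε c hqc (m : ZMod c) 1 = 0 := by
  have hl : p ^ j ∣ c := (pow_dvd_pow p hjk.le).trans hqc
  have hconductor {d r : ℕ} (h : p ^ (r + 1) ∣ d) : ¬ d ∣ b * p ^ r := fun hd ↦ by
    have h' := h.trans hd
    rw [pow_succ', Nat.mul_dvd_mul_iff_right (pow_pos hp.pos r)] at h'
    exact hpb h'
  have hplus (m : (ZMod c)ˣ) := by
    refine sum_unitsMap_eq_one_eq_zero (d := b * p ^ (k - 1)) (l := p ^ j) (c := c) ?_ hl ?_ ?_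
      (DirichletCharacter.changeLevel hqc ψ) ?_ m
    · exact hc ▸ mul_dvd_mul_left b (pow_dvd_pow p (Nat.sub_le k 1))
    · exact (pow_dvd_pow p (Nat.le_sub_one_of_lt hjk)).mul_left b
    · rw [hc, mul_assoc, ← pow_add]
      exact mul_dvd_mul_left b (pow_dvd_pow p (by omega))
    · rw [← map_pow, DirichletCharacter.conductor_changeLevel, hψ]
      exact hconductor (by rw [Nat.sub_add_cancel (by omega)])
  have hminus := sum_unitsMap_neg_eq_one_eq_zero (d := b * p ^ (k - j)) (l := p ^ j) (c := c)
    (hc ▸ mul_dvd_mul_left b (pow_dvd_pow p (Nat.sub_le k j))) hl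
    (by rw [hc, mul_assoc, ← pow_add, Nat.sub_add_cancel hjk.le])
    (DirichletCharacter.changeLevel hqc ψ) η (hconductor hcond)
  simp_rw [← Finset.mul_sum] at hminus
  simp_rw [cosetSum_units_one p k j hp.ne_zero hjk.le ψ ε c hqc hl, hplus, mul_zero, zero_add,
    mul_left_comm (η _), ← Finset.mul_sum, hminus, mul_zero]
end

section
/- Let b be a positive integer not divisible by p and let c = b·q. Then ∑_{m mod c, gcd(m,c)=1} σ_{ψ,ε}(m,1;c) = ε·μ(b)²·φ(p^{j+k}), where μ is the Möbius function and φ is Euler's totient function. -/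
open Complex Finset

/-- The primitive `n`-th roots of unity sum to `μ n`. -/
lemma sum_primitiveRoots_eq_moebius (n : ℕ) (hn : 0 < n) :
    ∑ ζ ∈ primitiveRoots n ℂ, ζ = ((ArithmeticFunction.moebius n : ℤ) : ℂ) := by
  have key : ∀ n > 0, ∑ d ∈ n.divisors, ∑ ζ ∈ primitiveRoots d ℂ, ζ
      = if n = 1 then (1 : ℂ) else 0 := by
    intro n hn
    rw [← Finset.sum_biUnion fun _ _ _ _ h ↦ IsPrimitiveRoot.disjoint h,
      ← IsPrimitiveRoot.nthRoots_one_eq_biUnion_primitiveRoots]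
    split_ifs with h1
    · subst h1
      have : Polynomial.nthRootsFinset 1 (1 : ℂ) = {1} := by
        ext
        simp [Polynomial.mem_nthRootsFinset]
      rw [this, Finset.sum_singleton]
    · obtain ⟨ζ, hζ⟩ : ∃ ζ : ℂ, IsPrimitiveRoot ζ n :=
        ⟨_, Complex.isPrimitiveRoot_exp n hn.ne'⟩
      have hmaps : Set.MapsTo (ζ * ·) (Polynomial.nthRootsFinset n (1 : ℂ))
          (Polynomial.nthRootsFinset n (1 : ℂ)) := fun x hx ↦ by
        simp only [Finset.mem_coe, Polynomial.mem_nthRootsFinset hn] at hx ⊢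
        rw [mul_pow, hx, hζ.pow_eq_one, one_mul]
      have hinj : Set.InjOn (ζ * ·) (Polynomial.nthRootsFinset n (1 : ℂ)) :=
        (mul_right_injective₀ (hζ.ne_zero hn.ne')).injOn
      have hsum : ∑ x ∈ Polynomial.nthRootsFinset n (1 : ℂ), ζ * x
          = ∑ x ∈ Polynomial.nthRootsFinset n (1 : ℂ), x :=
        Finset.sum_nbij (ζ * ·) hmaps hinj
          (Finset.surjOn_of_injOn_of_card_le _ hmaps hinj le_rfl) fun _ _ ↦ rfl
      rw [← Finset.mul_sum] at hsum
      exact eq_zero_of_mul_eq_self_left (hζ.ne_one (by lia)) hsum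
  rw [← ArithmeticFunction.sum_eq_iff_sum_mul_moebius_eq.mp key n hn,
    Finset.sum_eq_single (n, 1)]
  · simp
  · rintro ⟨a, d⟩ had hne
    rw [Nat.mem_divisorsAntidiagonal] at had
    have : d ≠ 1 := by
      rintro rfl
      exact hne (by simpa using had.1)
    simp [this]
  · intro h
    exact absurd (by simp [hn.ne']) h

lemma stdAddChar_unit_mem_primitiveRoots (n : ℕ) [NeZero n] (u : (ZMod n)ˣ) :
    ZMod.stdAddChar (u : ZMod n) ∈ primitiveRoots n ℂ := by
  rw [mem_primitiveRoots (NeZero.pos n)]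
  have h := Complex.isPrimitiveRoot_exp_of_coprime (u : ZMod n).val n (NeZero.ne n)
    (ZMod.val_coe_unit_coprime u)
  rw [ZMod.stdAddChar_apply, ZMod.toCircle_apply]
  convert h using 2
  ring

lemma sum_units_stdAddChar (n : ℕ) [NeZero n] :
    ∑ u : (ZMod n)ˣ, ZMod.stdAddChar (u : ZMod n)
      = ((ArithmeticFunction.moebius n : ℤ) : ℂ) := by
  rw [← sum_primitiveRoots_eq_moebius n (NeZero.pos n)]
  have hmaps : Set.MapsTo (fun u : (ZMod n)ˣ ↦ ZMod.stdAddChar (u : ZMod n))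
      (Finset.univ : Finset (ZMod n)ˣ) (primitiveRoots n ℂ) :=
    fun u _ ↦ stdAddChar_unit_mem_primitiveRoots n u
  have hinj : Set.InjOn (fun u : (ZMod n)ˣ ↦ ZMod.stdAddChar (u : ZMod n))
      (Finset.univ : Finset (ZMod n)ˣ) :=
    (ZMod.injective_stdAddChar.comp Units.val_injective).injOn
  refine Finset.sum_nbij _ hmaps hinj
    (Finset.surjOn_of_injOn_of_card_le _ hmaps hinj ?_) fun _ _ ↦ rfl
  rw [Complex.card_primitiveRoots, Finset.card_univ, ZMod.card_units_eq_totient]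

lemma gaussSum_mul_gaussSum_inv_of_isPrimitive {N : ℕ} [NeZero N]
    {χ : DirichletCharacter ℂ N} (hχ : χ.IsPrimitive) {e : AddChar (ZMod N) ℂ}
    (he : e.IsPrimitive) :
    gaussSum χ e * gaussSum χ⁻¹ e = χ (-1) * N := by
  have h : ∀ y : ZMod N, gaussSum χ e * (χ⁻¹ y * e y)
      = ∑ x : ZMod N, χ x * e (y * (x + 1)) := fun y ↦ by
    rw [← mul_assoc, mul_comm (gaussSum χ e), ← gaussSum_mulShift_of_isPrimitive e hχ y,
      gaussSum, Finset.sum_mul]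
    refine Finset.sum_congr rfl fun x _ ↦ ?_
    rw [AddChar.mulShift_apply, mul_assoc, ← AddChar.map_add_eq_mul]
    ring_nf
  rw [gaussSum.eq_1 χ⁻¹, Finset.mul_sum, Finset.sum_congr rfl fun y _ ↦ h y, Finset.sum_comm]
  simp_rw [← Finset.mul_sum, AddChar.sum_mulShift _ he]
  rw [Finset.sum_eq_single (-1)]
  · simp
  · intro x _ hx
    rw [if_neg fun h ↦ hx (eq_neg_of_add_eq_zero_left h)]
    simp
  · simp

lemma gaussSum_eq_sum_units {N : ℕ} [NeZero N] (χ : DirichletCharacter ℂ N)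
    (e : AddChar (ZMod N) ℂ) :
    gaussSum χ e = ∑ u : (ZMod N)ˣ, χ (u : ZMod N) * e (u : ZMod N) := by
  symm
  refine Finset.sum_of_injOn (fun u : (ZMod N)ˣ ↦ (u : ZMod N)) Units.val_injective.injOn
    (by simp) (fun x _ hx ↦ ?_) fun _ _ ↦ rfl
  rw [MulChar.map_nonunit χ fun hu ↦ hx ⟨hu.unit, by simp, rfl⟩, zero_mul]

/-- The additive character modulo `b * q` splits along the Chinese remainder theorem. -/
lemma exists_stdAddChar_mul_eq {b q : ℕ} [NeZero b] [NeZero q] [NeZero (b * q)]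
    (hbq : b.Coprime q) :
    ∃ (γ : (ZMod b)ˣ) (e : AddChar (ZMod q) ℂ), e.IsPrimitive ∧ ∀ z : ZMod (b * q),
      ZMod.stdAddChar z
        = ZMod.stdAddChar ((γ : ZMod b) * ZMod.castHom (dvd_mul_right b q) (ZMod b) z)
          * e (ZMod.castHom (dvd_mul_left q b) (ZMod q) z) := by
  obtain ⟨β, γ, hβγ⟩ := Nat.isCoprime_iff_coprime.mpr hbq
  have hγ : IsUnit (γ : ZMod b) := by
    refine IsUnit.of_mul_eq_one (q : ZMod b) ?_
    simpa using congrArg (Int.cast : ℤ → ZMod b) hβγ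
  have hβ : IsUnit (β : ZMod q) := by
    refine IsUnit.of_mul_eq_one (b : ZMod q) ?_
    simpa using congrArg (Int.cast : ℤ → ZMod q) hβγ
  refine ⟨hγ.unit, ZMod.stdAddChar.mulShift (β : ZMod q), fun a ha ↦ ?_, fun z ↦ ?_⟩
  · rw [AddChar.mulShift_mulShift]
    exact ZMod.isPrimitive_stdAddChar q fun h ↦ ha (by simpa using hβ.mul_right_eq_zero.mp h)
  · obtain ⟨t, rfl⟩ := ZMod.intCast_surjective z
    rw [AddChar.mulShift_apply, IsUnit.unit_spec, map_intCast (ZMod.castHom (dvd_mul_right b q) (ZMod b)),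
      map_intCast (ZMod.castHom (dvd_mul_left q b) (ZMod q)), ← Int.cast_mul, ← Int.cast_mul, ZMod.stdAddChar_coe, ZMod.stdAddChar_coe, ZMod.stdAddChar_coe,
      ← Complex.exp_add]
    congr 1
    have hb : (b : ℂ) ≠ 0 := NeZero.ne _
    have hq : (q : ℂ) ≠ 0 := NeZero.ne _
    have h : (β : ℂ) * b + γ * q = 1 := by exact_mod_cast hβγ
    push_cast
    field_simp
    linear_combination (-(t : ℂ)) * h

/-- The Gauss sum modulo `b * q` of a character modulo `q`, over units. -/
lemma sum_units_mul_stdAddChar {b q : ℕ} [NeZero b] [NeZero q] [NeZero (b * q)]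
    (hbq : b.Coprime q) :
    ∃ e : AddChar (ZMod q) ℂ, e.IsPrimitive ∧ ∀ χ : DirichletCharacter ℂ q,
      ∑ u : (ZMod (b * q))ˣ, χ (ZMod.castHom (dvd_mul_left q b) (ZMod q) (u : ZMod (b * q)))
          * ZMod.stdAddChar (u : ZMod (b * q))
        = ((ArithmeticFunction.moebius b : ℤ) : ℂ) * gaussSum χ e := by
  obtain ⟨γ, e, he, hsplit⟩ := exists_stdAddChar_mul_eq hbq
  refine ⟨e, he, fun χ ↦ ?_⟩
  rw [← sum_units_stdAddChar b, gaussSum_eq_sum_units,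
    ← Equiv.sum_comp (Equiv.mulLeft γ) fun u ↦ ZMod.stdAddChar (u : ZMod b),
    Finset.sum_mul_sum, ← Fintype.sum_prod_type']
  refine Fintype.sum_equiv ((Units.mapEquiv (ZMod.chineseRemainder hbq).toMulEquiv).trans
    MulEquiv.prodUnits).toEquiv _ _ fun u ↦ ?_
  have h1 : ZMod.castHom (dvd_mul_right b q) (ZMod b) (u : ZMod (b * q))
      = (ZMod.chineseRemainder hbq u).1 :=
    (RingHom.congr_fun (Subsingleton.elim _
      ((RingHom.fst _ _).comp (ZMod.chineseRemainder hbq).toRingHom)) _)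
  have h2 : ZMod.castHom (dvd_mul_left q b) (ZMod q) (u : ZMod (b * q))
      = (ZMod.chineseRemainder hbq u).2 :=
    (RingHom.congr_fun (Subsingleton.elim _
      ((RingHom.snd _ _).comp (ZMod.chineseRemainder hbq).toRingHom)) _)
  rw [hsplit, h1, h2]
  simp [MulEquiv.prodUnits]
  ring

/-- Summing the twisted Kloosterman sums over `m` produces a product of two Gauss sums. -/
lemma sum_units_mul_SChiSq {q c : ℕ} [NeZero c] (h : q ∣ c) (χ : DirichletCharacter ℂ q) :
    ∑ m : (ZMod c)ˣ, χ (ZMod.castHom h (ZMod q) (m : ZMod c)) * SChiSq q c h χ m 1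
      = (∑ u : (ZMod c)ˣ, χ (ZMod.castHom h (ZMod q) (u : ZMod c))
            * ZMod.stdAddChar (u : ZMod c))
        * ∑ u : (ZMod c)ˣ, χ⁻¹ (ZMod.castHom h (ZMod q) (u : ZMod c))
            * ZMod.stdAddChar (u : ZMod c) := by
  simp_rw [SChiSq, eZMod_eq_stdAddChar, Finset.mul_sum]
  rw [Finset.sum_comm, ← Equiv.sum_comp (Equiv.inv (ZMod c)ˣ)]
  refine Finset.sum_congr rfl fun x _ ↦ ?_
  rw [Finset.sum_mul, ← Equiv.sum_comp (Equiv.mulRight x)]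
  refine Finset.sum_congr rfl fun m _ ↦ ?_
  have hx : IsUnit (ZMod.castHom h (ZMod q) (x : ZMod c)) := x.isUnit.map _
  have hinv : χ (ZMod.castHom h (ZMod q) ((x⁻¹ : (ZMod c)ˣ) : ZMod c))
      = χ⁻¹ (ZMod.castHom h (ZMod q) (x : ZMod c)) := by
    rw [MulChar.inv_apply]
    exact congrArg χ (Ring.inverse_unit (Units.map (ZMod.castHom h (ZMod q)).toMonoidHom x)).symm
  have hcancel : χ (ZMod.castHom h (ZMod q) (x : ZMod c))
      * χ⁻¹ (ZMod.castHom h (ZMod q) (x : ZMod c)) = 1 := by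
    rw [← MulChar.mul_apply, mul_inv_cancel, MulChar.one_apply hx]
  simp only [Equiv.inv_apply, Equiv.coe_mulRight, inv_inv, Units.val_mul, map_mul, hinv,
    Units.mul_inv_cancel_right, one_mul, AddChar.map_add_eq_mul]
  linear_combination (χ (ZMod.castHom h (ZMod q) (m : ZMod c))
    * χ⁻¹ (ZMod.castHom h (ZMod q) (x : ZMod c)) * ZMod.stdAddChar (m : ZMod c)
    * ZMod.stdAddChar (x : ZMod c)) * hcancel

/-- A twist of `ψ` by a character of smaller level stays primitive when `ψ ^ 2` is primitive. -/
lemma isPrimitive_mul_changeLevel {p k j : ℕ} (hp : p.Prime) (hjk : j < k)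
    {ψ : DirichletCharacter ℂ (p ^ k)} (hψ : (ψ ^ 2).conductor = p ^ k)
    (χ' : DirichletCharacter ℂ (p ^ j)) :
    (ψ * DirichletCharacter.changeLevel (pow_dvd_pow p hjk.le) χ').IsPrimitive := by
  have : NeZero (p ^ k) := ⟨(pow_pos hp.pos k).ne'⟩
  set θ := DirichletCharacter.changeLevel (pow_dvd_pow p hjk.le) χ' with hθ
  rw [DirichletCharacter.isPrimitive_def]
  obtain ⟨i, hik, hi⟩ := (Nat.dvd_prime_pow hp).mp (ψ * θ).conductor_dvd_level
  have hθj : θ⁻¹.conductor ∣ p ^ j := by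
    rw [DirichletCharacter.conductor_inv, hθ, DirichletCharacter.conductor_changeLevel]
    exact χ'.conductor_dvd_level
  have hψk : p ^ k ∣ ψ.conductor :=
    hψ.symm.dvd.trans (DirichletCharacter.conductor_pow_dvd ψ 2)
  have hdvd : ψ.conductor ∣ p ^ max i j := by
    have h := DirichletCharacter.conductor_mul_dvd_lcm_conductor (ψ * θ) θ⁻¹
    rw [mul_inv_cancel_right] at h
    refine h.trans (Nat.lcm_dvd ?_ ?_)
    · exact hi ▸ pow_dvd_pow p (le_max_left i j)
    · exact hθj.trans (pow_dvd_pow p (le_max_right i j))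
  have := (Nat.pow_dvd_pow_iff_le_right hp.one_lt).mp (hψk.trans hdvd)
  rw [hi, show i = k by lia]

/-- the zeroth Fourier coefficient of the coset sum is `ε·μ(b)²·φ(p^{j+k})`. -/
theorem fourier_cosetSum_principal (p : ℕ) (hp : p.Prime) (hodd : Odd p)
    (k : ℕ) (hk : 2 ≤ k) (j : ℕ) (hj : 1 ≤ j) (hjk : j < k)
    (ψ : DirichletCharacter ℂ (p^k)) (hψ : (ψ^2).conductor = p^k)
    (ε : ℤ) (hε : ε = 1 ∨ ε = -1)
    (b : ℕ) (hb : 0 < b) (hpb : ¬ p ∣ b)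
    (c : ℕ) [NeZero c] (hc : c = b * p ^ k) (hqc : p ^ k ∣ c) :
    ∑ m : (ZMod c)ˣ, cosetSum p k j hjk.le ψ ε c hqc (m : ZMod c) 1
      = (ε : ℂ) * ((ArithmeticFunction.moebius b : ℤ) : ℂ)^2 *
          (Nat.totient (p^(j+k)) : ℂ) := by
  have : NeZero b := ⟨hb.ne'⟩
  have : NeZero (p ^ k) := ⟨(pow_pos hp.pos k).ne'⟩
  have : NeZero (p ^ j) := ⟨(pow_pos hp.pos j).ne'⟩
  subst hc
  have hbq : b.Coprime (p ^ k) := (((Nat.Prime.coprime_iff_not_dvd hp).mpr hpb).symm).pow_right k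
  obtain ⟨e, he, hsum⟩ := sum_units_mul_stdAddChar hbq
  have hχ : ∀ χ' : DirichletCharacter ℂ (p ^ j),
      ∑ m : (ZMod (b * p ^ k))ˣ,
        (ψ * DirichletCharacter.changeLevel (pow_dvd_pow p hjk.le) χ')
            (ZMod.castHom hqc (ZMod (p ^ k)) (m : ZMod (b * p ^ k))) *
        (starRingEnd ℂ) ((ψ * DirichletCharacter.changeLevel (pow_dvd_pow p hjk.le) χ')
            (ZMod.castHom hqc (ZMod (p ^ k)) 1)) *
        (1 + (ε : ℂ) * (ψ * DirichletCharacter.changeLevel (pow_dvd_pow p hjk.le) χ') (-1)) *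
        SChiSq (p ^ k) (b * p ^ k) hqc
          (ψ * DirichletCharacter.changeLevel (pow_dvd_pow p hjk.le) χ') m 1
      = ((ArithmeticFunction.moebius b : ℤ) : ℂ) ^ 2 * (p ^ k : ℕ)
        * (ψ (-1) * χ' (-1) + ε) := by
    intro χ'
    have hprim := isPrimitive_mul_changeLevel hp hjk hψ χ'
    have hneg : (ψ * DirichletCharacter.changeLevel (pow_dvd_pow p hjk.le) χ') (-1)
        = ψ (-1) * χ' (-1) := by
      rw [MulChar.mul_apply]
      congr 1
      simpa using DirichletCharacter.changeLevel_eq_cast_of_dvd' χ' (pow_dvd_pow p hjk.le)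
        (a := -1) isCoprime_one_left.neg_left
    set χ := ψ * DirichletCharacter.changeLevel (pow_dvd_pow p hjk.le) χ'
    have hsq : χ (-1) * χ (-1) = 1 := by
      rw [← map_mul, neg_one_mul, neg_neg, map_one]
    have hK := sum_units_mul_SChiSq hqc χ
    rw [hsum χ, hsum χ⁻¹, mul_mul_mul_comm, gaussSum_mul_gaussSum_inv_of_isPrimitive hprim he] at hK
    calc _ = (1 + (ε : ℂ) * χ (-1)) * ∑ m : (ZMod (b * p ^ k))ˣ,
          χ (ZMod.castHom hqc (ZMod (p ^ k)) (m : ZMod (b * p ^ k)))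
            * SChiSq (p ^ k) (b * p ^ k) hqc χ m 1 := by
          rw [Finset.mul_sum]
          refine Finset.sum_congr rfl fun m _ ↦ ?_
          rw [map_one, map_one, map_one]
          ring
      _ = _ := by
          rw [hK, ← hneg]
          linear_combination ((ArithmeticFunction.moebius b : ℤ) : ℂ) ^ 2 * (p ^ k : ℕ) * ε * hsq
  simp_rw [cosetSum]
  rw [Finset.sum_comm, Finset.sum_congr rfl fun χ' _ ↦ hχ χ', ← Finset.mul_sum,
    Finset.sum_add_distrib, ← Finset.mul_sum]
  have hne : (-1 : ZMod (p ^ j)) ≠ 1 := by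
    have h2 : 2 < p := lt_of_le_of_ne hp.two_le fun h ↦ by
      rw [← h] at hodd
      exact absurd hodd (by decide)
    have : Fact (2 < p ^ j) := ⟨h2.trans_le (Nat.le_self_pow (by lia) p)⟩
    exact ZMod.neg_one_ne_one
  have hcard : Fintype.card (DirichletCharacter ℂ (p ^ j)) = (p ^ j).totient := by
    rw [← Nat.card_eq_fintype_card]
    exact DirichletCharacter.card_eq_totient_of_hasEnoughRootsOfUnity ℂ _
  have htot : (p ^ (j + k)).totient = p ^ k * (p ^ j).totient := by
    rw [Nat.totient_prime_pow hp (by lia), Nat.totient_prime_pow hp (by lia),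
      show j + k - 1 = k + (j - 1) by lia, pow_add, mul_assoc]
  rw [DirichletCharacter.sum_characters_eq_zero ℂ hne, Finset.sum_const, Finset.card_univ, hcard,
    htot, nsmul_eq_mul]
  push_cast
  ring
end

section
/- For every ε > 0 there exists a constant C = C(ε) > 0 such that for all positive integers A ≤ B and every positive integer c, ∑_{A ≤ r ≤ B} τ(r) · gcd(flrt(r), flrt(c)) ≤ C · B^ε · c^ε · (B − A + c^{1/2}). -/
open Finset

/-- The floor square root `flrt(n) = ∏_{p ∣ n} p^{⌊ν_p(n)/2⌋}`. -/
def flrt (n : ℕ) : ℕ := ∏ p ∈ n.primeFactors, p ^ (n.factorization p / 2)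

theorem flrt_sq_dvd {n : ℕ} (hn : n ≠ 0) : flrt n ^ 2 ∣ n := by
  have h : n.primeFactors.prod (fun p => p ^ n.factorization p) = n :=
    Nat.prod_factorization_pow_eq_self hn
  conv_rhs => rw [← h]
  rw [flrt, ← Finset.prod_pow]
  refine Finset.prod_dvd_prod_of_dvd _ _ fun p _ => ?_
  rw [← pow_mul]
  exact pow_dvd_pow _ (Nat.div_mul_le_self _ _)

theorem flrt_pos (n : ℕ) : 0 < flrt n :=
  Finset.prod_pos fun _ hp => pow_pos (Nat.pos_of_mem_primeFactors hp) _

/-- The divisor bound `τ(n) ≪ n ^ ε`. -/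
theorem exists_card_divisors_le_rpow {ε : ℝ} (hε : 0 < ε) :
    ∃ C : ℝ, 0 < C ∧ ∀ n : ℕ, n ≠ 0 → (n.divisors.card : ℝ) ≤ C * (n : ℝ) ^ ε := by
  obtain ⟨N, hN⟩ := exists_nat_ge ((2 : ℝ) ^ (1 / ε))
  have hlog : 0 < ε * Real.log 2 := mul_pos hε (Real.log_pos one_lt_two)
  set K : ℝ := 1 + 1 / (ε * Real.log 2) with hK
  have hK1 : 1 ≤ K := le_add_of_nonneg_right (by positivity)
  have local_bound : ∀ p a : ℕ, 2 ≤ p →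
      (a : ℝ) + 1 ≤ (if p < N then K else 1) * ((p : ℝ) ^ a) ^ ε := by
    intro p a hp
    have hp' : (2 : ℝ) ≤ p := by exact_mod_cast hp
    rw [← Real.rpow_natCast, ← Real.rpow_mul (by positivity), mul_comm (a : ℝ) ε]
    split_ifs with h
    · calc (a : ℝ) + 1 ≤ K * (ε * Real.log 2 * a + 1) := by
            have h1 : K * (ε * Real.log 2 * a + 1)
                = a + 1 + (ε * Real.log 2 * a + 1 / (ε * Real.log 2)) := by
              rw [hK]; field_simp; ring
            rw [h1]
            exact le_add_of_nonneg_right (by positivity)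
        _ ≤ K * (2 : ℝ) ^ (ε * a) := by
            rw [Real.rpow_def_of_pos two_pos]
            have := Real.add_one_le_exp (Real.log 2 * (ε * a))
            gcongr
            linarith
        _ ≤ K * (p : ℝ) ^ (ε * a) := by gcongr
    · have h2 : (2 : ℝ) ≤ (p : ℝ) ^ ε := by
        have h3 : (2 : ℝ) ^ (1 / ε) ≤ p := hN.trans (by exact_mod_cast not_lt.mp h)
        calc (2 : ℝ) = ((2 : ℝ) ^ (1 / ε)) ^ ε := by
              rw [← Real.rpow_mul two_pos.le, one_div_mul_cancel hε.ne', Real.rpow_one]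
          _ ≤ _ := by gcongr
      rw [one_mul, Real.rpow_mul (by positivity), Real.rpow_natCast]
      calc (a : ℝ) + 1 ≤ 2 ^ a := by exact_mod_cast Nat.lt_two_pow_self
        _ ≤ _ := by gcongr
  refine ⟨K ^ N, by positivity, fun n hn => ?_⟩
  have hprod : (n : ℝ) ^ ε = ∏ p ∈ n.primeFactors, ((p : ℝ) ^ n.factorization p) ^ ε := by
    rw [Real.finsetProd_rpow _ _ fun _ _ => by positivity]
    congr 1
    conv_lhs => rw [← Nat.prod_factorization_pow_eq_self hn]
    simp [Finsupp.prod]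
  rw [Nat.card_divisors hn, hprod]
  push_cast
  calc ∏ p ∈ n.primeFactors, ((n.factorization p : ℝ) + 1)
      ≤ ∏ p ∈ n.primeFactors, (if p < N then K else 1) * ((p : ℝ) ^ n.factorization p) ^ ε :=
        Finset.prod_le_prod (fun _ _ => by positivity) fun p hp =>
          local_bound p _ (Nat.prime_of_mem_primeFactors hp).two_le
    _ ≤ _ := by
        rw [Finset.prod_mul_distrib]
        gcongr
        rw [Finset.prod_ite, Finset.prod_const, Finset.prod_const_one, mul_one]
        refine pow_le_pow_right₀ hK1 ?_
        calc _ ≤ (Finset.range N).card := Finset.card_le_card fun p hp => by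
              simpa using (Finset.mem_filter.mp hp).2
          _ = N := Finset.card_range N

theorem card_filter_dvd_Icc_le {A B m : ℕ} (hA : 1 ≤ A) (hAB : A ≤ B) (hm : 0 < m) :
    (((Finset.Icc A B).filter (m ∣ ·)).card : ℝ) ≤ ((B : ℝ) - A) / m + 1 := by
  obtain ⟨a, rfl⟩ := Nat.exists_eq_add_of_le' hA
  have hunion : (Finset.Ioc 0 B).filter (m ∣ ·)
      = (Finset.Ioc 0 a).filter (m ∣ ·) ∪ (Finset.Icc (a + 1) B).filter (m ∣ ·) := by
    rw [← Finset.filter_union]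
    congr 1
    ext x
    simp only [Finset.mem_union, Finset.mem_Ioc, Finset.mem_Icc]
    omega
  have hdisj : Disjoint ((Finset.Ioc 0 a).filter (m ∣ ·))
      ((Finset.Icc (a + 1) B).filter (m ∣ ·)) := by
    refine Finset.disjoint_filter_filter (Finset.disjoint_left.mpr fun x hx hx' => ?_)
    simp only [Finset.mem_Ioc, Finset.mem_Icc] at hx hx'
    omega
  have hcard := congrArg Finset.card hunion
  rw [Finset.card_union_of_disjoint hdisj, Nat.Ioc_filter_dvd_card_eq_div,
    Nat.Ioc_filter_dvd_card_eq_div] at hcard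
  have hm' : (0 : ℝ) < m := by exact_mod_cast hm
  have hB : ((B / m : ℕ) : ℝ) ≤ B / m := Nat.cast_div_le
  have ha : ((a : ℝ) + 1) / m ≤ (a / m : ℕ) + 1 := by
    rw [div_le_iff₀ hm']
    exact_mod_cast (Nat.lt_mul_of_div_lt (Nat.lt_succ_self (a / m)) hm)
  have hcard' : ((B / m : ℕ) : ℝ) = (a / m : ℕ)
      + (((Finset.Icc (a + 1) B).filter (m ∣ ·)).card : ℝ) := by exact_mod_cast hcard
  push_cast
  rw [sub_div]
  linarith

theorem sum_gcd_flrt_le {A B c : ℕ} (hA : 1 ≤ A) (hAB : A ≤ B) (hc : c ≠ 0) :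
    ∑ r ∈ Finset.Icc A B, (Nat.gcd (flrt r) (flrt c) : ℝ)
      ≤ c.divisors.card * ((B : ℝ) - A + (c : ℝ) ^ ((1 : ℝ) / 2)) := by
  have hAB' : (0 : ℝ) ≤ (B : ℝ) - A := sub_nonneg.mpr (by exact_mod_cast hAB)
  have hsqrt : (flrt c : ℝ) ≤ (c : ℝ) ^ ((1 : ℝ) / 2) := by
    rw [← Real.sqrt_eq_rpow]
    refine Real.le_sqrt_of_sq_le ?_
    exact_mod_cast Nat.le_of_dvd (Nat.pos_of_ne_zero hc) (flrt_sq_dvd hc)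
  have hsub : (flrt c).divisors ⊆ c.divisors :=
    Nat.divisors_subset_of_dvd hc ((dvd_pow_self _ two_ne_zero).trans (flrt_sq_dvd hc))
  calc ∑ r ∈ Finset.Icc A B, (Nat.gcd (flrt r) (flrt c) : ℝ)
      ≤ ∑ r ∈ Finset.Icc A B, ∑ d ∈ (flrt c).divisors, if d ^ 2 ∣ r then (d : ℝ) else 0 := by
        refine Finset.sum_le_sum fun r hr => ?_
        have hr0 : r ≠ 0 := by
          have := (Finset.mem_Icc.mp hr).1
          omega
        have hdvd : Nat.gcd (flrt r) (flrt c) ^ 2 ∣ r :=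
          (pow_dvd_pow_of_dvd (Nat.gcd_dvd_left _ _) 2).trans (flrt_sq_dvd hr0)
        have := Finset.single_le_sum (s := (flrt c).divisors)
          (f := fun d : ℕ => if d ^ 2 ∣ r then (d : ℝ) else 0)
          (fun d _ => by positivity)
          (Nat.mem_divisors.mpr ⟨Nat.gcd_dvd_right (flrt r) (flrt c), (flrt_pos c).ne'⟩)
        simpa only [if_pos hdvd] using this
    _ = ∑ d ∈ (flrt c).divisors,
          (((Finset.Icc A B).filter (d ^ 2 ∣ ·)).card : ℝ) * d := by
        rw [Finset.sum_comm]
        refine Finset.sum_congr rfl fun d _ => ?_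
        rw [← Finset.sum_filter, Finset.sum_const, nsmul_eq_mul]
    _ ≤ ∑ d ∈ (flrt c).divisors, ((B : ℝ) - A + (c : ℝ) ^ ((1 : ℝ) / 2)) := by
        refine Finset.sum_le_sum fun d hd => ?_
        have hd0 : 0 < d := Nat.pos_of_mem_divisors hd
        have hd1 : (1 : ℝ) ≤ d := by exact_mod_cast hd0
        have hdc : (d : ℝ) ≤ flrt c := by exact_mod_cast Nat.divisor_le hd
        have hcount := card_filter_dvd_Icc_le hA hAB (pow_pos hd0 2)
        calc _ ≤ (((B : ℝ) - A) / ((d ^ 2 : ℕ) : ℝ) + 1) * d := by gcongr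
          _ = ((B : ℝ) - A) / d + d := by
              push_cast
              field_simp
          _ ≤ _ := add_le_add (div_le_self hAB' hd1) (hdc.trans hsqrt)
    _ ≤ _ := by
        rw [Finset.sum_const, nsmul_eq_mul]
        gcongr

/-- on-average bound for `τ(r)·gcd(flrt r, flrt c)`. -/
theorem sum_tau_gcd_flrt_bound :
    ∀ ε : ℝ, 0 < ε → ∃ C : ℝ, 0 < C ∧
      ∀ A B c : ℕ, 1 ≤ A → A ≤ B → 1 ≤ c →
        (∑ r ∈ Finset.Icc A B,
            ((r.divisors.card : ℝ) * (Nat.gcd (flrt r) (flrt c) : ℝ)))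
          ≤ C * (B : ℝ) ^ ε * (c : ℝ) ^ ε *
              ((B : ℝ) - (A : ℝ) + (c : ℝ) ^ ((1 : ℝ)/2)) := by
  intro ε hε
  obtain ⟨C, hC, hdiv⟩ := exists_card_divisors_le_rpow hε
  refine ⟨C * C, mul_pos hC hC, fun A B c hA hAB hc => ?_⟩
  have hc0 : c ≠ 0 := Nat.one_le_iff_ne_zero.mp hc
  have hAB' : (0 : ℝ) ≤ (B : ℝ) - A := sub_nonneg.mpr (by exact_mod_cast hAB)
  calc ∑ r ∈ Finset.Icc A B, ((r.divisors.card : ℝ) * (Nat.gcd (flrt r) (flrt c) : ℝ))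
      ≤ ∑ r ∈ Finset.Icc A B, C * (B : ℝ) ^ ε * (Nat.gcd (flrt r) (flrt c) : ℝ) := by
        refine Finset.sum_le_sum fun r hr => ?_
        obtain ⟨hAr, hrB⟩ := Finset.mem_Icc.mp hr
        have hle := hdiv r (by omega)
        gcongr
        exact hle.trans (by gcongr)
    _ = C * (B : ℝ) ^ ε * ∑ r ∈ Finset.Icc A B, (Nat.gcd (flrt r) (flrt c) : ℝ) := by
        rw [Finset.mul_sum]
    _ ≤ C * (B : ℝ) ^ ε * ((C * (c : ℝ) ^ ε) * ((B : ℝ) - A + (c : ℝ) ^ ((1 : ℝ) / 2))) := by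
        have hsum := sum_gcd_flrt_le hA hAB hc0
        gcongr
        exact hsum.trans (by gcongr; exact hdiv c hc0)
    _ = _ := by ring
end

section
/- Let g : ℝ → ℝ be an even, smooth, compactly supported function, and define the entire function φ(z) = ∫_ℝ g(x) e^{2πixz} dx for z ∈ ℂ. Then lim_{σ → 0⁺} ∫_ℝ e^{−2πit} · φ(iσ − t)/(σ + it) dt = π · (φ(0) − ∫_{−1}^{1} g(t) dt). -/
open Complex MeasureTheory Filter

open scoped FourierTransform

/-- Parseval-type formula: a Schwartz function against an integrable function. -/
lemma integral_fourier_mul_fourier_schwartz (f : SchwartzMap ℝ ℂ) {k : ℝ → ℂ}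
    (hk : Integrable k) :
    ∫ t : ℝ, 𝓕 (f : ℝ → ℂ) t * 𝓕 k t = ∫ u : ℝ, f (-u) * k u := by
  have hF : Integrable (𝓕 (f : ℝ → ℂ)) := (𝓕 f).integrable
  have hflip := VectorFourier.integral_fourierIntegral_smul_eq_flip (L := innerₗ ℝ)
    Real.continuous_fourierChar continuous_inner hk hF
  have hinv (u : ℝ) : 𝓕 (𝓕 (f : ℝ → ℂ)) u = f (-u) := by
    have h := congrFun (f.continuous.fourierInv_fourier_eq f.integrable hF) (-u)
    rwa [Real.fourierInv_eq_fourier_neg, neg_neg] at h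
  have hflip' : ∫ t : ℝ, 𝓕 k t * 𝓕 (f : ℝ → ℂ) t =
      ∫ u : ℝ, k u * 𝓕 (𝓕 (f : ℝ → ℂ)) u := by
    simpa using! hflip
  simp_rw [hinv] at hflip'
  simpa only [mul_comm] using hflip'

/-- The one-sided exponential `u ↦ 2π e^{-2πσu}` on `(0, ∞)`. -/
noncomputable def oneSidedExp (σ : ℝ) : ℝ → ℂ :=
  (Set.Ioi (0 : ℝ)).indicator fun u => 2 * Real.pi * cexp (-(2 * Real.pi * σ) * u)

lemma integrable_oneSidedExp {σ : ℝ} (hσ : 0 < σ) : Integrable (oneSidedExp σ) := by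
  refine (integrable_indicator_iff measurableSet_Ioi).2 (Integrable.const_mul ?_ _)
  refine integrableOn_exp_mul_complex_Ioi ?_ 0
  have : (-(2 * Real.pi * σ) : ℂ) = ((-(2 * Real.pi * σ) : ℝ) : ℂ) := by push_cast; ring
  rw [this, ofReal_re]
  have := Real.pi_pos
  have : 0 < 2 * Real.pi * σ := by positivity
  linarith

lemma fourier_oneSidedExp {σ : ℝ} (hσ : 0 < σ) (t : ℝ) :
    𝓕 (oneSidedExp σ) t = 1 / (σ + I * t) := by
  have hpi := Real.pi_pos
  have hne : (σ + I * t : ℂ) ≠ 0 := fun h => by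
    have := congrArg re h
    simp at this
    exact hσ.ne' this
  have hre : (-(2 * Real.pi) * (σ + I * t) : ℂ).re < 0 := by
    have : (-(2 * Real.pi) * (σ + I * t) : ℂ).re = -(2 * Real.pi * σ) := by simp
    rw [this]
    have : 0 < 2 * Real.pi * σ := by positivity
    linarith
  have hpt (v : ℝ) : cexp (((-2 * Real.pi * v * t : ℝ) : ℂ) * I) • oneSidedExp σ v =
      (Set.Ioi (0 : ℝ)).indicator
        (fun u : ℝ => 2 * Real.pi * cexp (-(2 * Real.pi) * (σ + I * t) * u)) v := by
    unfold oneSidedExp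
    by_cases hv : v ∈ Set.Ioi (0 : ℝ)
    · simp only [Set.indicator_of_mem hv, smul_eq_mul]
      rw [mul_left_comm, ← Complex.exp_add]
      congr 2
      push_cast
      ring
    · simp [Set.indicator_of_notMem hv]
  rw [Real.fourier_real_eq_integral_exp_smul]
  simp_rw [hpt]
  rw [integral_indicator measurableSet_Ioi, integral_const_mul,
    integral_exp_mul_complex_Ioi hre]
  have : (Real.pi : ℂ) ≠ 0 := by exact_mod_cast hpi.ne'
  simp
  field_simp

/-- Pairing the Fourier transform of a weighted translate of `g` with `1 / (σ + it)`. -/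
lemma integral_exp_mul_div_eq {g : ℝ → ℝ} (hsmooth : ContDiff ℝ (⊤ : ℕ∞) g)
    (hsupp : HasCompactSupport g) (heven : ∀ x, g (-x) = g x) {φ : ℂ → ℂ}
    (hφ : ∀ z : ℂ, φ z = ∫ x : ℝ, (g x : ℂ) * cexp (2 * Real.pi * I * x * z))
    {σ : ℝ} (hσ : 0 < σ) :
    ∫ t : ℝ, cexp (-(2 * Real.pi * I * t)) * φ (I * σ - t) / (σ + I * t) =
      cexp (2 * Real.pi * σ) * (2 * Real.pi * ∫ u in Set.Ioi (1 : ℝ), (g u : ℂ)) := by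
  let w : ℝ → ℂ := fun y => (g (y - 1) : ℂ) * cexp (-(2 * Real.pi * σ * ((y - 1 : ℝ) : ℂ)))
  have hws : HasCompactSupport w := by
    have h1 : HasCompactSupport (fun y : ℝ => g (y - 1)) := by
      simpa [sub_eq_add_neg] using! hsupp.comp_homeomorph (Homeomorph.addRight (-1 : ℝ))
    exact (h1.comp_left (g := ((↑) : ℝ → ℂ)) ofReal_zero).mul_right
  have hwd : ContDiff ℝ (⊤ : ℕ∞) w := by
    have h1 : ContDiff ℝ (⊤ : ℕ∞) (fun y : ℝ => (g (y - 1) : ℂ)) :=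
      ofRealCLM.contDiff.comp (hsmooth.comp (contDiff_id.sub contDiff_const))
    have h2 : ContDiff ℝ (⊤ : ℕ∞) (fun y : ℝ => ((y - 1 : ℝ) : ℂ)) :=
      ofRealCLM.contDiff.comp (contDiff_id.sub contDiff_const)
    exact h1.mul (contDiff_const.mul h2).neg.cexp
  let f : SchwartzMap ℝ ℂ := hws.toSchwartzMap hwd
  have hfw : (f : ℝ → ℂ) = w := rfl
  have hfour (t : ℝ) : 𝓕 (f : ℝ → ℂ) t = cexp (-(2 * Real.pi * I * t)) * φ (I * σ - t) := by
    rw [hfw, Real.fourier_real_eq_integral_exp_smul, hφ, ← integral_const_mul]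
    symm
    rw [← integral_sub_right_eq_self _ (1 : ℝ)]
    refine integral_congr_ae (ae_of_all _ fun y => ?_)
    simp only [w, smul_eq_mul]
    rw [mul_left_comm, mul_left_comm (cexp (((-2 * Real.pi * y * t : ℝ) : ℂ) * I)), ← Complex.exp_add,
      ← Complex.exp_add]
    congr 2
    push_cast
    linear_combination (2 * Real.pi * (y - 1) * σ : ℂ) * I_sq
  have hpair := integral_fourier_mul_fourier_schwartz f (integrable_oneSidedExp hσ)
  simp_rw [hfour, fourier_oneSidedExp hσ, mul_one_div] at hpair
  have hpt (u : ℝ) : f (-u) * oneSidedExp σ u = (Set.Ioi (0 : ℝ)).indicator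
      (fun u : ℝ => cexp (2 * Real.pi * σ) * (2 * Real.pi) * (g (u + 1) : ℂ)) u := by
    rw [hfw]
    unfold oneSidedExp
    by_cases hu : u ∈ Set.Ioi (0 : ℝ)
    · simp only [Set.indicator_of_mem hu, w]
      have hg : g (-u - 1) = g (u + 1) := by rw [← heven (u + 1)]; ring_nf
      have he : cexp (2 * Real.pi * σ) = cexp (-(2 * Real.pi * σ * ((-u - 1 : ℝ) : ℂ))) *
          cexp (-(2 * Real.pi * σ) * u) := by
        rw [← Complex.exp_add]
        congr 1
        push_cast
        ring
      rw [hg, he]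
      ring
    · simp [Set.indicator_of_notMem hu]
  have hshift : ∫ u in Set.Ioi (0 : ℝ), (g (u + 1) : ℂ) = ∫ u in Set.Ioi (1 : ℝ), (g u : ℂ) := by
    simpa using (measurePreserving_add_right volume (1 : ℝ)).setIntegral_preimage_emb
      (measurableEmbedding_addRight 1) (fun u : ℝ => (g u : ℂ)) (Set.Ioi 1)
  simp_rw [hpt] at hpair
  rw [hpair, integral_indicator measurableSet_Ioi, integral_const_mul, hshift, mul_assoc]

/-- For an even integrable function, twice the tail integral is the total minus the centre. -/
lemma two_mul_integral_Ioi_of_even {g : ℝ → ℂ} (hg : Integrable g) (heven : ∀ x, g (-x) = g x)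
    (a : ℝ) : 2 * ∫ u in Set.Ioi a, g u = (∫ u, g u) - ∫ u in (-a)..a, g u := by
  have h1 : ∫ u in Set.Iic (-a), g u = ∫ u in Set.Ioi a, g u := by
    rw [← integral_comp_neg_Ioi]
    simp_rw [heven]
  have h2 := intervalIntegral.integral_Iic_sub_Iic hg.integrableOn hg.integrableOn
    (a := -a) (b := a)
  have h3 := intervalIntegral.integral_Iic_add_Ioi hg.integrableOn hg.integrableOn (b := a)
  rw [h1] at h2
  linear_combination h3 - h2

/-- the limit as `σ → 0⁺` of `∫_ℝ e^{-2πit}·φ(iσ - t)/(σ + it) dt` equals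
`π·(φ(0) - ∫_{-1}^1 g)`, where `φ(z) = ∫ g(x) e^{2πixz} dx`. -/
theorem limit_special_main_term (g : ℝ → ℝ) (hsmooth : ContDiff ℝ (⊤ : ℕ∞) g)
    (hsupp : HasCompactSupport g) (heven : ∀ x, g (-x) = g x)
    (φ : ℂ → ℂ)
    (hφ : ∀ z : ℂ, φ z = ∫ x : ℝ, (g x : ℂ) * Complex.exp (2 * Real.pi * Complex.I * x * z)) :
    Tendsto (fun σ : ℝ =>
        ∫ t : ℝ, Complex.exp (-(2 * Real.pi * Complex.I * t)) *
          φ (Complex.I * σ - t) / (σ + Complex.I * t))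
      (nhdsWithin 0 (Set.Ioi 0))
      (nhds ((Real.pi : ℂ) * (φ 0 - ∫ t in (-1 : ℝ)..1, (g t : ℂ)))) := by
  have hint : Integrable (fun x : ℝ => (g x : ℂ)) :=
    (hsmooth.continuous.integrable_of_hasCompactSupport hsupp).ofReal
  have hφ0 : φ 0 = ∫ x : ℝ, (g x : ℂ) := by simp [hφ]
  have htail := two_mul_integral_Ioi_of_even hint (fun x => by rw [heven]) 1
  have hlim : Tendsto (fun σ : ℝ => cexp (2 * Real.pi * σ) *
      (2 * Real.pi * ∫ u in Set.Ioi (1 : ℝ), (g u : ℂ))) (nhdsWithin 0 (Set.Ioi 0))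
      (nhds ((Real.pi : ℂ) * (φ 0 - ∫ t in (-1 : ℝ)..1, (g t : ℂ)))) := by
    have hcont : Continuous (fun σ : ℝ => cexp (2 * Real.pi * σ) *
        (2 * Real.pi * ∫ u in Set.Ioi (1 : ℝ), (g u : ℂ))) := by fun_prop
    have h0 := (hcont.tendsto 0).mono_left (nhdsWithin_le_nhds (s := Set.Ioi 0))
    convert h0 using 2
    rw [hφ0, ← htail]
    simp
    ring
  refine hlim.congr' ?_
  filter_upwards [self_mem_nhdsWithin] with σ hσ
  exact (integral_exp_mul_div_eq hsmooth hsupp heven hφ hσ).symm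
end
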